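/- arXiv:math/0610343 — 2 statements merged into one kernel-verified Lean document; each statement's English description precedes it below -/
import Mathlib

section
/- The set P_∞ ∪ {∞} is a simply connected subset of the Riemann sphere ℂ̂ (i.e. the corresponding subspace is simply connected). -/
open Filter Topology OnePoint

/-- The Riemann sphere as the one-point compactification of `ℂ`. -/
notation "RSphere" => OnePoint ℂ

/-- The quadratic rational map `R_a(z) = a/(z² + 2z)` on the Riemann sphere, with
`R_a(0) = R_a(−2) = ∞` and `R_a(∞) = 0`. -/
noncomputable def Rhat (a : ℂ) : RSphere → RSphere := fun z =>
  match z with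
  | ∞ => ((0 : ℂ) : RSphere)
  | (w : ℂ) => if w ^ 2 + 2 * w = 0 then ∞ else ((a / (w ^ 2 + 2 * w) : ℂ) : RSphere)

/-- The basin of attraction of the superattracting 2-cycle `∞ ↦ 0 ↦ ∞` of `R_a`. -/
def sphereBasin (a : ℂ) : Set RSphere :=
  {z | Tendsto (fun n => (Rhat a)^[2 * n] z) atTop (𝓝 ∞) ∨
       Tendsto (fun n => (Rhat a)^[2 * n] z) atTop (𝓝 ((0 : ℂ) : RSphere))}

/-- `A_∞(a)`: the connected component of the basin containing `∞`. -/
noncomputable def Ainf (a : ℂ) : Set RSphere := connectedComponentIn (sphereBasin a) ∞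

/-- `A_0(a)`: the connected component of the basin containing `0`. -/
noncomputable def Azero (a : ℂ) : Set RSphere :=
  connectedComponentIn (sphereBasin a) ((0 : ℂ) : RSphere)

/-- `P_∞`: the parameters for which the critical value `−a` lies in `A_∞(a)`. -/
def Pinf : Set ℂ := {a | a ≠ 0 ∧ (((-a : ℂ) : RSphere) ∈ Ainf a)}

section
open Filter Topology Set Metric

/-- Near a critical point a nonconstant analytic function is not injective, at any nearby value. -/
theorem two_preimages_of_deriv_zero {f : ℂ → ℂ} {y : ℂ} (hf : AnalyticAt ℂ f y)
    (hnc : ¬ ∀ᶠ z in 𝓝 y, f z = f y) (hd : deriv f y = 0) {U : Set ℂ} (hU : U ∈ 𝓝 y) :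
    ∃ ε > 0, ∀ c : ℂ, 0 < ‖c - f y‖ → ‖c - f y‖ < ε →
      ∃ z₁ ∈ U, ∃ z₂ ∈ U, z₁ ≠ z₂ ∧ f z₁ = c ∧ f z₂ = c := by
  have hF : AnalyticAt ℂ (fun z => f z - f y) y := hf.sub analyticAt_const
  have hne : ¬ ∀ᶠ z in 𝓝 y, (fun z => f z - f y) z = 0 := by
    simpa [sub_eq_zero] using hnc
  obtain ⟨n, g, hg, hg0, hfg⟩ := (hF.exists_eventuallyEq_pow_smul_nonzero_iff).2 hne
  have hfy := hfg.self_of_nhds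
  have hn0 : n ≠ 0 := by
    rintro rfl; simp at hfy; exact hg0 hfy.symm
  have hn1 : n ≠ 1 := by
    rintro rfl
    have h1 : HasDerivAt (fun z => (z - y) ^ 1 • g z) (g y) y := by
      have := ((hasDerivAt_id y).sub_const y).mul hg.differentiableAt.hasDerivAt
      simpa [Pi.mul_def] using this
    have h2 : HasDerivAt (fun z => f z - f y) (g y) y := h1.congr_of_eventuallyEq hfg
    have h3 : HasDerivAt (fun z => f z - f y) (deriv f y) y :=
      hf.differentiableAt.hasDerivAt.sub_const _
    rw [hd] at h3
    exact hg0 (h2.unique h3)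
  obtain ⟨c0, hc0⟩ : ∃ c0 : ℂ, c0 ^ n = g y := IsAlgClosed.exists_pow_nat_eq _ (Nat.pos_of_ne_zero hn0)
  have hc0' : c0 ≠ 0 := by
    rintro rfl; rw [zero_pow hn0] at hc0; exact hg0 hc0.symm
  set h : ℂ → ℂ := fun z => (z - y) * (c0 * (g z / g y) ^ ((1 : ℂ) / n)) with hh
  have hk : AnalyticAt ℂ (fun z => c0 * (g z / g y) ^ ((1 : ℂ) / n)) y := by
    refine analyticAt_const.mul (AnalyticAt.cpow (hg.div analyticAt_const hg0) analyticAt_const ?_)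
    simp [hg0]
  have hha : AnalyticAt ℂ h y := (analyticAt_id.sub analyticAt_const).mul hk
  have hhd : HasDerivAt h c0 y := by
    have := ((hasDerivAt_id y).sub_const y).mul hk.differentiableAt.hasDerivAt
    simpa [Pi.mul_def, hg0, hh] using this
  have hhn : ∀ᶠ z in 𝓝 y, f z - f y = h z ^ n := by
    filter_upwards [hfg] with z hz
    have hn' : (n : ℂ) ≠ 0 := by exact_mod_cast hn0
    rw [hz, hh]
    simp only [smul_eq_mul, mul_pow]
    rw [hc0, ← Complex.cpow_mul_nat, one_div, inv_mul_cancel₀ hn', Complex.cpow_one]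
    field_simp
  have hhy : h y = 0 := by simp [hh]
  have hopen : 𝓝 (h y) ≤ map h (𝓝 y) := by
    refine hha.eventually_constant_or_nhds_le_map_nhds.resolve_left ?_
    intro hc
    have := (hasDerivAt_const y (h y)).congr_of_eventuallyEq hc
    exact hc0' (hhd.unique this)
  have hV : h '' (U ∩ {z | f z - f y = h z ^ n}) ∈ 𝓝 (0 : ℂ) := by
    rw [hhy] at hopen
    exact hopen (image_mem_map (inter_mem hU hhn))
  obtain ⟨ε, hε, hball⟩ := Metric.mem_nhds_iff.1 hV
  refine ⟨ε ^ n, pow_pos hε n, fun c hc1 hc2 => ?_⟩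
  obtain ⟨w, hw⟩ : ∃ w : ℂ, w ^ n = c - f y := IsAlgClosed.exists_pow_nat_eq _ (Nat.pos_of_ne_zero hn0)
  have hwε : ‖w‖ < ε := by
    rw [← hw, norm_pow] at hc2
    exact lt_of_pow_lt_pow_left₀ n hε.le hc2
  have hw0 : w ≠ 0 := by
    rintro rfl; rw [← hw, zero_pow hn0] at hc1; simp at hc1
  have hprim := Complex.isPrimitiveRoot_exp n hn0
  set ζ := Complex.exp (2 * Real.pi * Complex.I / n)
  have hζ1 : ζ ≠ 1 := hprim.ne_one (by omega)
  have hζn : ‖ζ‖ = 1 := hprim.norm'_eq_one hn0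
  obtain ⟨z₁, ⟨h1U, h1⟩, h1w⟩ := hball (show w ∈ ball 0 ε by simpa using hwε)
  obtain ⟨z₂, ⟨h2U, h2⟩, h2w⟩ := hball (show ζ * w ∈ ball 0 ε by simpa [hζn] using hwε)
  refine ⟨z₁, h1U, z₂, h2U, ?_, ?_, ?_⟩
  · rintro rfl
    rw [h1w] at h2w
    exact hζ1 (mul_right_cancel₀ hw0 (by rw [← h2w, one_mul]))
  · simp only [mem_ofPred_eq] at h1
    rw [h1w, hw] at h1; simpa using h1
  · simp only [mem_ofPred_eq] at h2
    rw [h2w, mul_pow, hprim.pow_eq_one, one_mul, hw] at h2; simpa using h2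

theorem simplyConnected_of_proper {Y : Set ℂ} {f : ℂ → ℂ} (hY : IsOpen Y)
    (hf : DifferentiableOn ℂ f Y) (hlt : ∀ y ∈ Y, ‖f y‖ < 1)
    (hcpt : ∀ r < 1, IsCompact {y | y ∈ Y ∧ ‖f y‖ ≤ r}) (h0 : (0 : ℂ) ∈ Y) (hf0 : f 0 = 0)
    (hz : ∀ y ∈ Y, f y = 0 → y = 0) (hd : deriv f 0 ≠ 0) : SimplyConnectedSpace Y := by
  have han : ∀ y ∈ Y, AnalyticAt ℂ f y := fun y hy => hf.analyticAt (hY.mem_nhds hy)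
  have hcont : ∀ y ∈ Y, ContinuousAt f y := fun y hy => (han y hy).continuousAt
  -- `f` is nowhere locally constant
  have hnc : ∀ y ∈ Y, ¬ ∀ᶠ z in 𝓝 y, f z = f y := by
    intro y hy hcst
    set c := f y
    set E : Set ℂ := {z | z ∈ Y ∧ ∀ᶠ w in 𝓝 z, f w = c}
    have hEo : IsOpen E := by
      rw [isOpen_iff_mem_nhds]
      rintro z ⟨hzY, hzc⟩
      filter_upwards [hY.mem_nhds hzY, hzc.eventually_nhds] with w h1 h2 using ⟨h1, h2⟩
    have hEK : E ⊆ {y | y ∈ Y ∧ ‖f y‖ ≤ ‖c‖} := by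
      rintro z ⟨hzY, hzc⟩
      exact ⟨hzY, by rw [hzc.self_of_nhds]⟩
    have hEc : IsClosed E := by
      refine isClosed_of_closure_subset fun z hzE => ?_
      have hzK := (hcpt ‖c‖ (hlt y hy)).isClosed.closure_subset_iff.2 hEK hzE
      refine ⟨hzK.1, ?_⟩
      have hfr : ∃ᶠ w in 𝓝 z, f w = c ∧ ∀ᶠ v in 𝓝 w, f v = c := by
        refine (mem_closure_iff_frequently.1 hzE).mono ?_
        rintro w ⟨_, hw⟩
        exact ⟨hw.self_of_nhds, hw⟩
      rcases (han z hzK.1).eventually_eq_or_eventually_ne (analyticAt_const (v := c)) with h | h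
      · exact h
      · exfalso
        rw [eventually_nhdsWithin_iff] at h
        obtain ⟨w, ⟨hw1, hw2⟩, hw3⟩ := (hfr.and_eventually h.eventually_nhds).exists
        have h4 : ∀ᶠ v in 𝓝 w, v = z := by
          filter_upwards [hw2, hw3] with v hv1 hv2
          by_contra hne
          exact hv2 hne hv1
        have : ({z} : Set ℂ) ∈ 𝓝 w := h4
        have hwz : w = z := h4.self_of_nhds
        subst hwz
        exact (NormedField.nhdsNE_neBot w).ne (by
          rw [nhdsWithin, inf_principal_eq_bot]; simpa using this)
    have hEb : Bornology.IsBounded E := (hcpt ‖c‖ (hlt y hy)).isBounded.subset hEK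
    have huniv : E = univ := IsClopen.eq_univ ⟨hEc, hEo⟩ ⟨y, hy, hcst⟩
    rw [huniv] at hEb
    exact NormedSpace.unbounded_univ ℂ ℂ hEb
  have hop : ∀ y ∈ Y, 𝓝 (f y) ≤ map f (𝓝 y) := fun y hy =>
    (han y hy).eventually_constant_or_nhds_le_map_nhds.resolve_left (hnc y hy)
  -- the extension step
  have step : ∀ r : ℝ, 0 ≤ r → r < 1 → InjOn f {y | y ∈ Y ∧ ‖f y‖ < r} →
      ∃ r' > r, InjOn f {y | y ∈ Y ∧ ‖f y‖ < r'} := by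
    intro r hr0 hr1 hinj
    have near : ∀ c : ℂ, ‖c‖ ≤ r → 0 < r → ∀ U ∈ 𝓝 c, ∃ c' ∈ U, ‖c'‖ < r := by
      intro c hc hr U hU
      have : c ∈ closure (ball (0 : ℂ) r) := by
        rw [closure_ball _ hr.ne']; simpa using hc
      obtain ⟨c', h1, h2⟩ := mem_closure_iff_nhds.1 this U hU
      exact ⟨c', h1, by simpa using h2⟩
    set K := {y | y ∈ Y ∧ ‖f y‖ ≤ r}
    have hK : IsCompact K := hcpt r hr1
    have hKinj : InjOn f K := by
      rcases hr0.eq_or_lt with rfl | hr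
      · rintro y₁ ⟨h1, h1'⟩ y₂ ⟨h2, h2'⟩ _
        rw [hz y₁ h1 (by simpa using h1'), hz y₂ h2 (by simpa using h2')]
      rintro y₁ ⟨h1, h1'⟩ y₂ ⟨h2, h2'⟩ heq
      by_contra hne
      obtain ⟨U₁, U₂, hU1, hU2, hy1, hy2, hdis⟩ := t2_separation hne
      have hV1 : f '' (U₁ ∩ Y) ∈ 𝓝 (f y₁) :=
        hop y₁ h1 (image_mem_map (inter_mem (hU1.mem_nhds hy1) (hY.mem_nhds h1)))
      have hV2 : f '' (U₂ ∩ Y) ∈ 𝓝 (f y₁) := by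
        rw [heq]
        exact hop y₂ h2 (image_mem_map (inter_mem (hU2.mem_nhds hy2) (hY.mem_nhds h2)))
      obtain ⟨c', ⟨⟨z₁, ⟨hz1, hz1Y⟩, hz1c⟩, ⟨z₂, ⟨hz2, hz2Y⟩, hz2c⟩⟩, hc'⟩ :=
        near (f y₁) h1' hr _ (inter_mem hV1 hV2)
      have : z₁ = z₂ := hinj ⟨hz1Y, by rw [hz1c]; exact hc'⟩ ⟨hz2Y, by rw [hz2c]; exact hc'⟩
        (hz1c.trans hz2c.symm)
      subst this
      exact hdis.le_bot ⟨hz1, hz2⟩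
    have hder : ∀ y ∈ K, deriv f y ≠ 0 := by
      rintro y ⟨hy, hy'⟩ hdy
      rcases hr0.eq_or_lt with rfl | hr
      · rw [hz y hy (by simpa using hy')] at hdy; exact hd hdy
      obtain ⟨ε, hε, H⟩ := two_preimages_of_deriv_zero (han y hy) (hnc y hy) hdy (hY.mem_nhds hy)
      have hU : ball (f y) ε ∩ ({f y}ᶜ : Set ℂ) ∩ ball 0 r ≠ ∅ := by
        obtain ⟨c', h1, h2⟩ := near (f y) hy' hr _ (ball_mem_nhds _ hε)
        have h3 : ball (f y) ε ∩ ball 0 r ∈ 𝓝 c' :=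
          (isOpen_ball.inter isOpen_ball).mem_nhds ⟨h1, by simpa using h2⟩
        have h4 : (ball (f y) ε ∩ ball 0 r) ∩ ({f y}ᶜ : Set ℂ) |>.Nonempty :=
          (dense_compl_singleton (f y)).inter_open_nonempty _ (isOpen_ball.inter isOpen_ball)
            ⟨c', h1, by simpa using h2⟩
        obtain ⟨d, ⟨hd1, hd2⟩, hd3⟩ := h4
        exact Set.nonempty_iff_ne_empty.1 ⟨d, ⟨hd1, hd3⟩, hd2⟩
      obtain ⟨c', ⟨h1, h2⟩, h3⟩ := Set.nonempty_iff_ne_empty.2 hU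
      have h3' : ‖c'‖ < r := by simpa using h3
      obtain ⟨z₁, hz1, z₂, hz2, hne, e1, e2⟩ := H c' (by
        rw [norm_pos_iff, sub_ne_zero]; exact h2) (by simpa [dist_eq_norm] using h1)
      exact hne (hinj ⟨hz1, by rw [e1]; exact h3'⟩ ⟨hz2, by rw [e2]; exact h3'⟩ (e1.trans e2.symm))
    obtain ⟨t, ht, htinj⟩ := hKinj.exists_mem_nhdsSet hK (fun x hx => hcont x hx.1) (by
      intro x hx
      have hs : HasStrictDerivAt f (deriv f x) x := (han x hx.1).hasStrictDerivAt
      have := (hs.hasStrictFDerivAt_equiv (hder x hx)).toOpenPartialHomeomorph f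
      refine ⟨((hs.hasStrictFDerivAt_equiv (hder x hx)).toOpenPartialHomeomorph f).source, ?_, ?_⟩
      · exact ((hs.hasStrictFDerivAt_equiv (hder x hx)).toOpenPartialHomeomorph f).open_source.mem_nhds
          (hs.hasStrictFDerivAt_equiv (hder x hx)).mem_toOpenPartialHomeomorph_source
      · exact ((hs.hasStrictFDerivAt_equiv (hder x hx)).toOpenPartialHomeomorph f).injOn)
    rw [mem_nhdsSet_iff_exists] at ht
    obtain ⟨V, hVo, hKV, hVt⟩ := ht
    obtain ⟨r1, hr1a, hr1b⟩ := exists_between hr1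
    have hC : IsCompact ({y | y ∈ Y ∧ ‖f y‖ ≤ r1} \ V) := (hcpt r1 hr1b).diff hVo
    by_cases hne : ({y | y ∈ Y ∧ ‖f y‖ ≤ r1} \ V).Nonempty
    · obtain ⟨m, hm, hmin⟩ := hC.exists_isMinOn hne
        (f := fun y => ‖f y‖) (fun y hy => (hcont y hy.1.1).norm.continuousWithinAt)
      have hmr : r < ‖f m‖ := by
        by_contra hle
        exact hm.2 (hKV ⟨hm.1.1, not_lt.1 hle⟩)
      refine ⟨min r1 ‖f m‖, lt_min hr1a hmr, htinj.mono ?_⟩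
      rintro y ⟨hyY, hy⟩
      apply hVt
      by_contra hyV
      have := hmin (a := y) ⟨⟨hyY, (hy.trans_le (min_le_left _ _)).le⟩, hyV⟩
      exact absurd (hy.trans_le (min_le_right _ _)) (not_lt.2 this)
    · refine ⟨r1, hr1a, htinj.mono ?_⟩
      rintro y ⟨hyY, hy⟩
      apply hVt
      by_contra hyV
      exact hne ⟨y, ⟨hyY, hy.le⟩, hyV⟩
  -- global injectivity
  have hinj : InjOn f Y := by
    set S : Set ℝ := {r | 0 ≤ r ∧ r ≤ 1 ∧ InjOn f {y | y ∈ Y ∧ ‖f y‖ < r}}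
    have hS0 : (0 : ℝ) ∈ S := ⟨le_rfl, zero_le_one, by
      rintro y ⟨_, hy⟩; exact absurd hy (not_lt.2 (norm_nonneg _))⟩
    have hSb : BddAbove S := ⟨1, fun r hr => hr.2.1⟩
    set R := sSup S
    have hR0 : 0 ≤ R := le_csSup hSb hS0
    have hR1 : R ≤ 1 := csSup_le ⟨0, hS0⟩ fun r hr => hr.2.1
    have hRinj : InjOn f {y | y ∈ Y ∧ ‖f y‖ < R} := by
      rintro y₁ ⟨h1, h1'⟩ y₂ ⟨h2, h2'⟩ heq
      obtain ⟨r, hr, hlt'⟩ := exists_lt_of_lt_csSup ⟨0, hS0⟩ h1'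
      exact hr.2.2 ⟨h1, hlt'⟩ ⟨h2, by rw [← heq]; exact hlt'⟩ heq
    have : R = 1 := by
      by_contra hne
      have hRlt : R < 1 := lt_of_le_of_ne hR1 hne
      obtain ⟨r', hr', hinj'⟩ := step R hR0 hRlt hRinj
      have hmS : min r' 1 ∈ S := ⟨le_min (hR0.trans hr'.le) zero_le_one, min_le_right _ _,
        fun y₁ h1 y₂ h2 heq => hinj' ⟨h1.1, h1.2.trans_le (min_le_left _ _)⟩
          ⟨h2.1, h2.2.trans_le (min_le_left _ _)⟩ heq⟩
      exact absurd (le_csSup hSb hmS) (not_le.2 (lt_min hr' hRlt))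
    rw [this] at hRinj
    intro y₁ h1 y₂ h2 heq
    exact hRinj ⟨h1, hlt _ h1⟩ ⟨h2, hlt _ h2⟩ heq
  -- surjectivity
  have himo : ∀ U ⊆ Y, IsOpen U → IsOpen (f '' U) := by
    intro U hUY hU
    rw [isOpen_iff_mem_nhds]
    rintro _ ⟨y, hy, rfl⟩
    exact hop y (hUY hy) (image_mem_map (hU.mem_nhds hy))
  have himg : f '' Y = ball (0 : ℂ) 1 := by
    apply Subset.antisymm
    · rintro _ ⟨y, hy, rfl⟩; simpa using hlt y hy
    · have hpc : IsPreconnected (ball (0 : ℂ) 1) := (convex_ball 0 1).isPreconnected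
      refine hpc.subset_of_closure_inter_subset (himo Y Subset.rfl hY)
        (⟨0, by simp, 0, h0, hf0⟩ : (ball (0 : ℂ) 1 ∩ f '' Y).Nonempty) ?_
      rintro c ⟨hc, hc1⟩
      have hc1' : ‖c‖ < 1 := by simpa using hc1
      obtain ⟨r, hr1, hr2⟩ := exists_between hc1'
      have hcl : IsClosed (f '' {y | y ∈ Y ∧ ‖f y‖ ≤ r}) :=
        ((hcpt r hr2).image_of_continuousOn
          fun y hy => (hcont y hy.1).continuousWithinAt).isClosed
      have : c ∈ f '' {y | y ∈ Y ∧ ‖f y‖ ≤ r} := by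
        rw [← hcl.closure_eq, mem_closure_iff_nhds]
        intro U hU
        obtain ⟨_, ⟨hw1, hw2⟩, ⟨y, hy, rfl⟩⟩ := mem_closure_iff_nhds.1 hc (U ∩ ball 0 r)
          (inter_mem hU (isOpen_ball.mem_nhds (by simpa using hr1)))
        exact ⟨f y, hw1, y, ⟨hy, by simpa using (mem_ball_zero_iff.1 hw2).le⟩, rfl⟩
      obtain ⟨y, hy, rfl⟩ := this
      exact ⟨y, hy.1, rfl⟩
  have hemb : IsOpenEmbedding (fun y : Y => f y) := by
    refine IsOpenEmbedding.of_continuous_injective_isOpenMap ?_ ?_ ?_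
    · exact continuous_iff_continuousAt.2 fun y => (hcont y y.2).comp continuousAt_subtype_val
    · intro a b hab
      exact Subtype.ext (hinj a.2 b.2 hab)
    · intro U hU
      have := himo (Subtype.val '' U) (by rintro _ ⟨y, _, rfl⟩; exact y.2) (hY.isOpenMap_subtype_val U hU)
      rwa [image_image] at this
  have hrange : range (fun y : Y => f y) = ball (0 : ℂ) 1 := by
    rw [← himg]; ext c; simp
  have e : Y ≃ₜ ball (0 : ℂ) 1 := hemb.toIsEmbedding.toHomeomorph.trans (Homeomorph.setCongr hrange)
  have : ContractibleSpace (ball (0 : ℂ) 1) :=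
    (convex_ball (0 : ℂ) 1).contractibleSpace ⟨0, by simp⟩
  exact e.toHomotopyEquiv.simplyConnectedSpace
end

section
open Filter Topology Set Metric

theorem contAt_partial {U : Set (ℂ × ℂ)} {f : ℂ × ℂ → ℂ} (hU : IsOpen U) (hc : ContinuousOn f U)
    (hs : ∀ p ∈ U, DifferentiableAt ℂ (fun t => f (p.1, t)) p.2) {p : ℂ × ℂ} (hp : p ∈ U) :
    ContinuousAt (fun q : ℂ × ℂ => deriv (fun t => f (q.1, t)) q.2) p := by
  obtain ⟨a0, t0⟩ := p
  obtain ⟨ε, hε, hb⟩ := Metric.isOpen_iff.1 hU _ hp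
  have hmem : ∀ a ∈ ball a0 ε, ∀ t ∈ ball t0 ε, (a, t) ∈ U := fun a ha t ht =>
    hb (by rw [← ball_prod_same]; exact ⟨ha, ht⟩)
  have hlu : TendstoLocallyUniformlyOn (fun (q : ℂ × ℂ) (t : ℂ) => f (q.1, t))
      (fun t => f (a0, t)) (𝓝 (a0, t0)) (ball t0 ε) := by
    rw [Metric.tendstoLocallyUniformlyOn_iff]
    intro δ hδ t ht
    have hca : ContinuousAt f (a0, t) :=
      hc.continuousAt (hU.mem_nhds (hmem _ (mem_ball_self hε) _ ht))
    have h1 := Metric.tendsto_nhds.1 hca (δ/2) (by positivity)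
    obtain ⟨V, hV, W, hW, hVW⟩ := Filter.eventually_prod_iff.1 (by rwa [nhds_prod_eq] at h1)
    refine ⟨{t | W t}, mem_nhdsWithin_of_mem_nhds hW, ?_⟩
    have : ∀ᶠ q : ℂ × ℂ in 𝓝 (a0, t0), V q.1 := continuousAt_fst.eventually hV
    filter_upwards [this] with q hq y hy
    have e1 := hVW hq hy
    have e2 := hVW hV.self_of_nhds hy
    calc _ ≤ dist (f (a0, y)) (f (a0, t)) + dist (f (q.1, y)) (f (a0, t)) :=
          dist_triangle_right _ _ _
      _ < δ := by linarith
  have hdo : ∀ a ∈ ball a0 ε, DifferentiableOn ℂ (fun t => f (a, t)) (ball t0 ε) :=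
    fun a ha t ht => (hs _ (hmem a ha t ht)).differentiableWithinAt
  have hev : ∀ᶠ q : ℂ × ℂ in 𝓝 (a0, t0), DifferentiableOn ℂ (fun t => f (q.1, t)) (ball t0 ε) := by
    have : ∀ᶠ q : ℂ × ℂ in 𝓝 (a0, t0), q.1 ∈ ball a0 ε :=
      continuousAt_fst.eventually (ball_mem_nhds _ hε)
    filter_upwards [this] with q hq using hdo _ hq
  have hd := hlu.deriv hev isOpen_ball
  have := hd.tendsto_comp (x := t0) (g := fun q : ℂ × ℂ => q.2) ?_ (mem_ball_self hε) ?_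
  · exact this
  · exact ((hdo a0 (mem_ball_self hε)).deriv isOpen_ball).continuousOn _ (mem_ball_self hε)
  · rw [isOpen_ball.nhdsWithin_eq (mem_ball_self hε)]
    exact continuousAt_snd

theorem osgood {U : Set (ℂ × ℂ)} {f : ℂ × ℂ → ℂ} (hU : IsOpen U) (hc : ContinuousOn f U)
    (hs1 : ∀ p ∈ U, DifferentiableAt ℂ (fun t => f (p.1, t)) p.2)
    (hs2 : ∀ p ∈ U, DifferentiableAt ℂ (fun a => f (a, p.2)) p.1) :
    DifferentiableOn ℂ f U := by
  intro p hp
  have c2 := contAt_partial hU hc hs1 hp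
  have c1 : ContinuousAt (fun q : ℂ × ℂ => deriv (fun a => f (a, q.2)) q.1) p := by
    have hU' : IsOpen (Prod.swap ⁻¹' U) := hU.preimage continuous_swap
    have := contAt_partial (f := f ∘ Prod.swap) hU' (hc.comp continuous_swap.continuousOn
      (fun x hx => hx)) (fun q hq => hs2 _ hq) (p := p.swap) (by simpa using hp)
    exact ContinuousAt.comp (f := Prod.swap) (x := p) this continuous_swap.continuousAt
  have key := hasStrictFDerivAt_uncurry_coprod (𝕜 := ℂ) (u := p) (f := fun a t => f (a, t))
    (f₁ := fun a t => ContinuousLinearMap.toSpanSingleton ℂ (deriv (fun a => f (a, t)) a))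
    (f₂ := fun a t => ContinuousLinearMap.toSpanSingleton ℂ (deriv (fun t => f (a, t)) t))
    (by filter_upwards [hU.mem_nhds hp] with v hv
        exact (hs2 v hv).hasDerivAt.hasFDerivAt)
    (by filter_upwards [hU.mem_nhds hp] with v hv
        exact (hs1 v hv).hasDerivAt.hasFDerivAt)
    ((ContinuousLinearMap.toSpanSingletonCLE (𝕜 := ℂ) (E := ℂ)).continuous.continuousAt.comp c1)
    ((ContinuousLinearMap.toSpanSingletonCLE (𝕜 := ℂ) (E := ℂ)).continuous.continuousAt.comp c2)
  exact key.hasFDerivAt.differentiableAt.differentiableWithinAt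
end

section
open Filter Topology Set Metric

noncomputable def csq (w : ℂ) : ℂ := w ^ (2⁻¹ : ℂ)

theorem csq_sq (w : ℂ) : csq w ^ 2 = w := by
  simp [csq]

theorem csq_re (w : ℂ) : 0 ≤ (csq w).re := by
  unfold csq
  rw [Complex.cpow_inv_two_re]
  positivity

theorem csq_diff {w : ℂ} (hw : w ∈ Complex.slitPlane) : DifferentiableAt ℂ csq w := by
  unfold csq
  exact DifferentiableAt.cpow_const differentiableAt_id hw

theorem mem_slit {w : ℂ} {c : ℝ} (h : ‖w - c‖ < c) : w ∈ Complex.slitPlane := by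
  left
  have := (Complex.abs_re_le_norm (w - c)).trans_lt h
  simp at this
  have := (abs_lt.1 this).1
  linarith

theorem csq_near_one {w : ℂ} : ‖csq w - 1‖ ≤ ‖w - 1‖ := by
  have h : w - 1 = (csq w - 1) * (csq w + 1) := by linear_combination -(csq_sq w)
  have h2 : 1 ≤ ‖csq w + 1‖ := by
    have := Complex.re_le_norm (csq w + 1)
    simp at this
    linarith [csq_re w]
  rw [h, norm_mul]
  nlinarith [norm_nonneg (csq w - 1)]

theorem csq_near_two {w : ℂ} : ‖csq w - 2‖ ≤ ‖w - 4‖ / 2 := by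
  have h : w - 4 = (csq w - 2) * (csq w + 2) := by linear_combination -(csq_sq w)
  have h2 : 2 ≤ ‖csq w + 2‖ := by
    have := Complex.re_le_norm (csq w + 2)
    simp at this
    linarith [csq_re w]
  rw [h, norm_mul]
  nlinarith [norm_nonneg (csq w - 2)]

noncomputable def thA (a t y : ℂ) : ℂ := csq (1 + a * t / (y - t))
noncomputable def tuA (a t y : ℂ) : ℂ := csq ((1 + thA a t y) * (y - t) + t)

def Omg : Set (ℂ × ℂ) := {p | ‖p.2‖ * (1 + ‖p.1‖) < 1/100}

theorem Omg_open : IsOpen Omg := by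
  unfold Omg
  exact isOpen_lt (by fun_prop) (by fun_prop)

theorem Omg_sq {a t : ℂ} (h : (a, t) ∈ Omg) : (a, t ^ 2) ∈ Omg := by
  simp only [Omg, mem_ofPred_eq, norm_pow] at *
  nlinarith [norm_nonneg a, norm_nonneg t, mul_nonneg (norm_nonneg a) (norm_nonneg t)]

theorem yt_lb {t y : ℂ} (ht : ‖t‖ ≤ 1/100) (hy : ‖y - 2‖ ≤ 1/100) : 1.9 ≤ ‖y - t‖ := by
  have : (2:ℂ) = (y - t) - (y - 2) + t := by ring
  have h2 : ‖(2:ℂ)‖ ≤ ‖y - t‖ + ‖y - 2‖ + ‖t‖ := by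
    conv_lhs => rw [this]
    exact (norm_add_le _ _).trans (by gcongr; exact norm_sub_le _ _)
  simp at h2
  linarith

theorem yt_ub {t y : ℂ} (ht : ‖t‖ ≤ 1/100) (hy : ‖y - 2‖ ≤ 1/100) : ‖y - t‖ ≤ 2.1 := by
  have : y - t = (y - 2) - t + 2 := by ring
  have h2 : ‖y - t‖ ≤ ‖y - 2‖ + ‖t‖ + ‖(2:ℂ)‖ := by
    conv_lhs => rw [this]
    exact (norm_add_le _ _).trans (by gcongr; exact norm_sub_le _ _)
  simp at h2
  linarith

theorem Omg_t {a t : ℂ} (h : (a, t) ∈ Omg) : ‖t‖ ≤ 1/100 ∧ ‖a * t‖ ≤ 1/100 := by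
  simp only [Omg, mem_ofPred_eq] at h
  rw [norm_mul]
  constructor <;> nlinarith [norm_nonneg a, norm_nonneg t, mul_nonneg (norm_nonneg a) (norm_nonneg t)]

theorem q_bd {a t y : ℂ} (h : (a, t) ∈ Omg) (hy : ‖y - 2‖ ≤ 1/100) :
    ‖a * t / (y - t)‖ ≤ 1/100 := by
  obtain ⟨h1, h2⟩ := Omg_t h
  have := yt_lb h1 hy
  rw [norm_div, div_le_iff₀ (by linarith)]
  nlinarith

theorem thA_bd {a t y : ℂ} (h : (a, t) ∈ Omg) (hy : ‖y - 2‖ ≤ 1/100) :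
    ‖thA a t y - 1‖ ≤ 1/100 := by
  refine csq_near_one.trans ?_
  have := q_bd h hy
  simpa using this

theorem arg_bd {a t y : ℂ} (h : (a, t) ∈ Omg) (hy : ‖y - 2‖ ≤ 1/100) :
    ‖(1 + thA a t y) * (y - t) + t - 4‖ ≤ ‖t‖ * (1 + ‖a‖) + 2 * ‖y - 2‖ := by
  obtain ⟨h1, h2⟩ := Omg_t h
  have h3 := yt_lb h1 hy
  have e : (1 + thA a t y) * (y - t) + t - 4 = (thA a t y - 1) * (y - t) + 2 * (y - 2) - t := by
    ring
  have h4 : ‖thA a t y - 1‖ * ‖y - t‖ ≤ ‖a‖ * ‖t‖ := by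
    have : ‖thA a t y - 1‖ ≤ ‖a * t / (y - t)‖ := by
      refine csq_near_one.trans (le_of_eq ?_)
      congr 1; ring
    rw [norm_div, norm_mul, le_div_iff₀ (by linarith)] at this
    exact this
  rw [e]
  calc _ ≤ ‖(thA a t y - 1) * (y - t)‖ + ‖2 * (y - 2)‖ + ‖t‖ :=
        (norm_sub_le _ _).trans (by gcongr; exact norm_add_le _ _)
    _ ≤ _ := by
      rw [norm_mul, norm_mul]; simp; linarith

theorem tuA_bd {a t y : ℂ} (h : (a, t) ∈ Omg) (hy : ‖y - 2‖ ≤ ‖t ^ 2‖ * (1 + ‖a‖)) :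
    ‖tuA a t y - 2‖ ≤ ‖t‖ * (1 + ‖a‖) := by
  obtain ⟨h1, h2⟩ := Omg_t h
  have h3 : ‖y - 2‖ ≤ (1/100) * (‖t‖ * (1 + ‖a‖)) := by
    refine hy.trans ?_
    rw [norm_pow]
    nlinarith [mul_nonneg (norm_nonneg t) (by positivity : 0 ≤ 1 + ‖a‖)]
  have h4 : ‖t‖ * (1 + ‖a‖) < 1/100 := h
  refine csq_near_two.trans ?_
  have := arg_bd h (y := y) (by linarith)
  linarith [mul_nonneg (norm_nonneg t) (by positivity : 0 ≤ 1 + ‖a‖)]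

theorem tuA_bd2 {a t y : ℂ} (h : (a, t) ∈ Omg) (hy : ‖y - 2‖ ≤ 1/100) :
    ‖tuA a t y - 2‖ ≤ 2/100 := by
  have h4 : ‖t‖ * (1 + ‖a‖) < 1/100 := h
  refine csq_near_two.trans ?_
  have := arg_bd h (y := y) hy
  linarith

theorem sq_diff {s1 s2 w1 w2 : ℂ} (h1 : s1 ^ 2 = w1) (h2 : s2 ^ 2 = w2) {c : ℝ} (hc : 0 < c)
    (h : c ≤ (s1 + s2).re) : ‖s1 - s2‖ ≤ ‖w1 - w2‖ / c := by
  have e : w1 - w2 = (s1 - s2) * (s1 + s2) := by rw [← h1, ← h2]; ring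
  have := h.trans (Complex.re_le_norm _)
  rw [le_div_iff₀ hc, e, norm_mul]
  gcongr

theorem re_near {w : ℂ} {c d : ℝ} (h : ‖w - c‖ ≤ d) : c - d ≤ w.re := by
  have := (Complex.abs_re_le_norm (w - c)).trans h
  simp at this
  linarith [(abs_le.1 this).1]

theorem thA_lip {a t y1 y2 : ℂ} (h : (a, t) ∈ Omg) (hy1 : ‖y1 - 2‖ ≤ 1/100)
    (hy2 : ‖y2 - 2‖ ≤ 1/100) : ‖thA a t y1 - thA a t y2‖ ≤ (1/100) * ‖y1 - y2‖ := by
  obtain ⟨h1, h2⟩ := Omg_t h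
  have l1 := yt_lb h1 hy1
  have l2 := yt_lb h1 hy2
  have r1 := re_near (c := 1) (by simpa using thA_bd h hy1)
  have r2 := re_near (c := 1) (by simpa using thA_bd h hy2)
  refine (sq_diff (c := 1) (csq_sq _) (csq_sq _) (by norm_num) ?_).trans ?_
  · unfold thA at r1 r2
    rw [Complex.add_re]; linarith
  · have n1 : y1 - t ≠ 0 := norm_pos_iff.1 (by linarith)
    have n2 : y2 - t ≠ 0 := norm_pos_iff.1 (by linarith)
    have : 1 + a * t / (y1 - t) - (1 + a * t / (y2 - t)) =
      -(a * t * (y1 - y2)) / ((y1 - t) * (y2 - t)) := by field_simp; ring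
    rw [this, div_one, norm_div, norm_neg, norm_mul, norm_mul (y1 - t),
      div_le_iff₀ (by nlinarith)]
    have : 1 ≤ ‖y1 - t‖ * ‖y2 - t‖ := by nlinarith
    calc ‖a * t‖ * ‖y1 - y2‖ ≤ (1/100) * ‖y1 - y2‖ := by gcongr
      _ ≤ _ := le_mul_of_one_le_right (by positivity) this

theorem tuA_lip {a t y1 y2 : ℂ} (h : (a, t) ∈ Omg) (hy1 : ‖y1 - 2‖ ≤ 1/100)
    (hy2 : ‖y2 - 2‖ ≤ 1/100) : ‖tuA a t y1 - tuA a t y2‖ ≤ 0.6 * ‖y1 - y2‖ := by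
  obtain ⟨h1, h2⟩ := Omg_t h
  have l2 := yt_ub h1 hy2
  have r1 := re_near (c := 2) (by simpa using tuA_bd2 h hy1)
  have r2 := re_near (c := 2) (by simpa using tuA_bd2 h hy2)
  refine (sq_diff (c := 3.9) (csq_sq _) (csq_sq _) (by norm_num) ?_).trans ?_
  · unfold tuA at r1 r2
    rw [Complex.add_re]; linarith
  · have : (1 + thA a t y1) * (y1 - t) + t - ((1 + thA a t y2) * (y2 - t) + t) =
      (2 + (thA a t y1 - 1)) * (y1 - y2) + (thA a t y1 - thA a t y2) * (y2 - t) := by ring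
    rw [div_le_iff₀ (by norm_num), this]
    have e1 := thA_bd h hy1
    have e2 := thA_lip h hy1 hy2
    have e3 : ‖2 + (thA a t y1 - 1)‖ ≤ 2.1 := by
      refine (norm_add_le _ _).trans ?_
      simp only [Complex.norm_ofNat]; linarith
    calc _ ≤ ‖2 + (thA a t y1 - 1)‖ * ‖y1 - y2‖ + ‖thA a t y1 - thA a t y2‖ * ‖y2 - t‖ := by
          refine (norm_add_le _ _).trans ?_
          rw [norm_mul, norm_mul]
      _ ≤ 2.1 * ‖y1 - y2‖ + (1/100 * ‖y1 - y2‖) * 2.1 := by gcongr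
      _ ≤ _ := by linarith [norm_nonneg (y1 - y2)]

noncomputable def tuk : ℕ → ℂ → ℂ → ℂ
  | 0, _, _ => 2
  | k + 1, a, t => tuA a t (tuk k a (t ^ 2))

theorem tuk_bd (k : ℕ) {a t : ℂ} (h : (a, t) ∈ Omg) : ‖tuk k a t - 2‖ ≤ ‖t‖ * (1 + ‖a‖) := by
  induction k generalizing t with
  | zero => simp [tuk]; positivity
  | succ k ih => exact tuA_bd h (ih (Omg_sq h))

theorem tuk_bd' (k : ℕ) {a t : ℂ} (h : (a, t) ∈ Omg) : ‖tuk k a t - 2‖ ≤ 1/100 :=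
  (tuk_bd k h).trans (le_of_lt h)

theorem tuk_succ (k : ℕ) {a t : ℂ} (h : (a, t) ∈ Omg) :
    dist (tuk k a t) (tuk (k+1) a t) ≤ 1 * 0.6 ^ k := by
  induction k generalizing t with
  | zero =>
    rw [dist_comm, dist_eq_norm]
    have := tuk_bd' 1 h
    simp [tuk] at *
    linarith
  | succ k ih =>
    have := tuA_lip h (tuk_bd' k (Omg_sq h)) (tuk_bd' (k+1) (Omg_sq h))
    rw [dist_eq_norm]
    refine this.trans ?_
    have := ih (Omg_sq h)
    rw [dist_eq_norm] at this
    rw [pow_succ (0.6:ℝ)]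
    linarith

noncomputable def tul (p : ℂ × ℂ) : ℂ := limUnder atTop (fun k => tuk k p.1 p.2)

theorem tul_tendsto {a t : ℂ} (h : (a, t) ∈ Omg) :
    Tendsto (fun k => tuk k a t) atTop (𝓝 (tul (a, t))) := by
  have : CauchySeq (fun k => tuk k a t) :=
    cauchySeq_of_le_geometric 0.6 1 (by norm_num) (fun k => tuk_succ k h)
  exact this.tendsto_limUnder

theorem tul_bd {a t : ℂ} (h : (a, t) ∈ Omg) : ‖tul (a, t) - 2‖ ≤ ‖t‖ * (1 + ‖a‖) :=
  le_of_tendsto ((tul_tendsto h).sub_const 2).norm (Eventually.of_forall fun k => tuk_bd k h)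

theorem tul_bd' {a t : ℂ} (h : (a, t) ∈ Omg) : ‖tul (a, t) - 2‖ ≤ 1/100 :=
  (tul_bd h).trans (le_of_lt h)

theorem tul_eq {a t : ℂ} (h : (a, t) ∈ Omg) : tul (a, t) = tuA a t (tul (a, t ^ 2)) := by
  have h1 := (tul_tendsto h).comp (tendsto_add_atTop_nat 1)
  refine tendsto_nhds_unique h1 ?_
  have h2 := tul_tendsto (Omg_sq h)
  rw [tendsto_iff_dist_tendsto_zero] at h2 ⊢
  refine squeeze_zero (fun _ => dist_nonneg) (fun k => ?_) (by simpa using h2.const_mul 0.6)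
  rw [dist_eq_norm, dist_eq_norm]
  exact tuA_lip h (tuk_bd' k (Omg_sq h)) (tul_bd' (Omg_sq h))

theorem tul_unif : TendstoUniformlyOn (fun k (p : ℂ × ℂ) => tuk k p.1 p.2) tul atTop Omg := by
  rw [Metric.tendstoUniformlyOn_iff]
  intro ε hε
  have : Tendsto (fun k : ℕ => 1 * (0.6:ℝ) ^ k / (1 - 0.6)) atTop (𝓝 0) := by
    have := tendsto_pow_atTop_nhds_zero_of_lt_one (r := (0.6:ℝ)) (by norm_num) (by norm_num)
    simpa using (this.const_mul 1).div_const (1 - 0.6)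
  filter_upwards [this.eventually (gt_mem_nhds hε)] with k hk
  rintro ⟨a, t⟩ h
  rw [dist_comm]
  exact (dist_le_of_le_geometric_of_tendsto 0.6 1 (by norm_num) (fun k => tuk_succ k h)
    (tul_tendsto h) k).trans_lt hk

theorem thA_slit {a t y : ℂ} (h : (a, t) ∈ Omg) (hy : ‖y - 2‖ ≤ 1/100) :
    1 + a * t / (y - t) ∈ Complex.slitPlane := by
  refine mem_slit (c := 1) ?_
  have := q_bd h hy
  simp only [Complex.ofReal_one, add_sub_cancel_left]
  linarith

theorem tuA_slit {a t y : ℂ} (h : (a, t) ∈ Omg) (hy : ‖y - 2‖ ≤ 1/100) :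
    (1 + thA a t y) * (y - t) + t ∈ Complex.slitPlane := by
  refine mem_slit (c := 4) ?_
  have := arg_bd h hy
  have h4 : ‖t‖ * (1 + ‖a‖) < 1/100 := h
  simp only [Complex.ofReal_ofNat]
  linarith

theorem yt_ne {a t y : ℂ} (h : (a, t) ∈ Omg) (hy : ‖y - 2‖ ≤ 1/100) : y - t ≠ 0 :=
  norm_pos_iff.1 (by linarith [yt_lb (Omg_t h).1 hy])

theorem thA_diff {Y : ℂ × ℂ → ℂ} (hY : DifferentiableOn ℂ Y Omg)
    (hb : ∀ p ∈ Omg, ‖Y p - 2‖ ≤ 1/100) :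
    DifferentiableOn ℂ (fun p => thA p.1 p.2 (Y p)) Omg := by
  intro p hp
  have hYp := (hY.differentiableAt (Omg_open.mem_nhds hp))
  refine DifferentiableAt.differentiableWithinAt ?_
  unfold thA
  refine DifferentiableAt.comp (g := csq) (f := fun p : ℂ × ℂ => 1 + p.1 * p.2 / (Y p - p.2)) p
    (csq_diff (thA_slit hp (hb p hp))) ?_
  have := yt_ne hp (hb p hp)
  fun_prop (disch := assumption)

theorem tuA_diff {Y : ℂ × ℂ → ℂ} (hY : DifferentiableOn ℂ Y Omg)
    (hb : ∀ p ∈ Omg, ‖Y p - 2‖ ≤ 1/100) :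
    DifferentiableOn ℂ (fun p => tuA p.1 p.2 (Y p)) Omg := by
  intro p hp
  have hYp := (hY.differentiableAt (Omg_open.mem_nhds hp))
  have ht := ((thA_diff hY hb).differentiableAt (Omg_open.mem_nhds hp))
  refine DifferentiableAt.differentiableWithinAt ?_
  unfold tuA
  refine DifferentiableAt.comp (g := csq)
    (f := fun p : ℂ × ℂ => (1 + thA p.1 p.2 (Y p)) * (Y p - p.2) + p.2) p
    (csq_diff (tuA_slit hp (hb p hp))) ?_
  fun_prop

theorem sqmap_diff {Y : ℂ × ℂ → ℂ} (hY : DifferentiableOn ℂ Y Omg) :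
    DifferentiableOn ℂ (fun p : ℂ × ℂ => Y (p.1, p.2 ^ 2)) Omg := by
  refine hY.comp (f := fun p : ℂ × ℂ => (p.1, p.2 ^ 2)) (by fun_prop) (fun p hp => Omg_sq hp)

theorem tuk_diff (k : ℕ) : DifferentiableOn ℂ (fun p : ℂ × ℂ => tuk k p.1 p.2) Omg := by
  induction k with
  | zero => simp [tuk]
  | succ k ih =>
    exact tuA_diff (Y := fun p => tuk k p.1 (p.2 ^ 2)) (sqmap_diff ih)
      (fun p hp => tuk_bd' k (Omg_sq hp))

theorem tul_diff : DifferentiableOn ℂ tul Omg := by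
  refine osgood Omg_open ?_ ?_ ?_
  · exact tul_unif.continuousOn (Frequently.of_forall fun k => (tuk_diff k).continuousOn)
  · rintro ⟨a, t⟩ hp
    have ho : IsOpen ((fun t => (a, t)) ⁻¹' Omg) := Omg_open.preimage (by fun_prop)
    have h1 := (tul_unif.comp (fun t => (a, t))).tendstoLocallyUniformlyOn.differentiableOn
      (Eventually.of_forall fun k => ((tuk_diff k).comp (f := fun t => (a, t))
        (by fun_prop) (fun t ht => ht))) ho
    exact h1.differentiableAt (ho.mem_nhds hp)
  · rintro ⟨a, t⟩ hp
    have ho : IsOpen ((fun a => (a, t)) ⁻¹' Omg) := Omg_open.preimage (by fun_prop)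
    have h1 := (tul_unif.comp (fun a => (a, t))).tendstoLocallyUniformlyOn.differentiableOn
      (Eventually.of_forall fun k => ((tuk_diff k).comp (f := fun a => (a, t))
        (by fun_prop) (fun t ht => ht))) ho
    exact h1.differentiableAt (ho.mem_nhds hp)

noncomputable def thl (p : ℂ × ℂ) : ℂ := thA p.1 p.2 (tul (p.1, p.2 ^ 2))

theorem thl_diff : DifferentiableOn ℂ thl Omg :=
  thA_diff (sqmap_diff tul_diff) (fun _ hp => tul_bd' (Omg_sq hp))

theorem tul_zero (a : ℂ) : tul (a, 0) = 2 := by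
  have h : (a, (0:ℂ)) ∈ Omg := by simp [Omg]
  have := tul_bd h
  simp at this
  exact sub_eq_zero.1 this

theorem thl_zero (a : ℂ) : thl (a, 0) = 1 := by
  simp [thl, thA, csq]

theorem tul_ne {a t : ℂ} (h : (a, t) ∈ Omg) : tul (a, t) ≠ 0 := by
  intro h0
  have := tul_bd' h
  rw [h0] at this
  norm_num at this

theorem thl_bd {a t : ℂ} (h : (a, t) ∈ Omg) : ‖thl (a, t) - 1‖ ≤ 1/100 :=
  thA_bd h (tul_bd' (Omg_sq h))

theorem thl_ne {a t : ℂ} (h : (a, t) ∈ Omg) : thl (a, t) ≠ 0 ∧ 1 + thl (a, t) ≠ 0 := by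
  have := re_near (c := 1) (by simpa using thl_bd h)
  constructor
  · intro h0; rw [h0] at this; norm_num at this
  · intro h0
    have : (1 + thl (a, t)).re = 0 := by rw [h0]; rfl
    simp at this
    linarith

theorem thl_sq {a t : ℂ} (h : (a, t) ∈ Omg) :
    thl (a, t) ^ 2 * (tul (a, t ^ 2) - t) = (tul (a, t ^ 2) - t) + a * t := by
  have := yt_ne h (tul_bd' (Omg_sq h))
  simp only [thl, thA, csq_sq]
  field_simp

theorem tul_sq {a t : ℂ} (h : (a, t) ∈ Omg) :
    tul (a, t) ^ 2 = (1 + thl (a, t)) * (tul (a, t ^ 2) - t) + t := by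
  rw [tul_eq h, tuA, csq_sq]; rfl
end

section
open Filter Topology Set Metric

structure Sol (a : ℂ) (r : ℝ) (τ θ : ℂ → ℂ) : Prop where
  rpos : 0 < r
  rle : r ≤ 1
  dτ : DifferentiableOn ℂ τ (ball 0 r)
  dθ : DifferentiableOn ℂ θ (ball 0 r)
  τ0 : τ 0 = 2
  θ0 : θ 0 = 1
  e3 : ∀ t ∈ ball (0:ℂ) r, θ t ^ 2 * (τ (t ^ 2) - t) = (τ (t ^ 2) - t) + a * t
  e4 : ∀ t ∈ ball (0:ℂ) r, τ t ^ 2 = (1 + θ t) * (τ (t ^ 2) - t) + t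
  nτ : ∀ t ∈ ball (0:ℂ) r, τ t ≠ 0
  nθ : ∀ t ∈ ball (0:ℂ) r, 1 + θ t ≠ 0
  germ : τ =ᶠ[𝓝 0] fun t => tul (a, t)

noncomputable def xf (τ : ℂ → ℂ) (t : ℂ) : ℂ := t / (τ (t ^ 2) - t)

def DD (r : ℝ) : Set ℂ := {t | ‖t‖ ^ 2 < r}

theorem DD_open (r : ℝ) : IsOpen (DD r) := isOpen_lt (by fun_prop) (by fun_prop)

theorem mem_DD {r : ℝ} {t : ℂ} : t ∈ DD r ↔ t ^ 2 ∈ ball (0:ℂ) r := by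
  simp [DD]

theorem sq_mem_ball {r : ℝ} (hr : r ≤ 1) {t : ℂ} (ht : t ∈ ball (0:ℂ) r) : t ^ 2 ∈ ball (0:ℂ) r := by
  simp at *
  nlinarith [norm_nonneg t]

theorem ball_sub_DD {r : ℝ} (hr : r ≤ 1) : ball (0:ℂ) r ⊆ DD r := fun _ ht =>
  mem_DD.2 (sq_mem_ball hr ht)

theorem DD_sq {r : ℝ} (hr : r ≤ 1) {t : ℂ} (ht : t ∈ DD r) : t ^ 2 ∈ DD r :=
  ball_sub_DD hr (mem_DD.1 ht)

theorem DD_eq_ball {r : ℝ} (hr : 0 ≤ r) : DD r = ball 0 (√r) := by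
  ext t
  simp [DD, Real.lt_sqrt (norm_nonneg t)]

theorem norm_lt_one_of_DD {r : ℝ} (hr : r ≤ 1) {t : ℂ} (ht : t ∈ DD r) : ‖t‖ < 1 := by
  have : ‖t‖ ^ 2 < r := ht
  nlinarith [norm_nonneg t]

theorem pow2s (t : ℂ) (n : ℕ) : t ^ 2 ^ (n + 1) = (t ^ 2 ^ n) ^ 2 := by
  rw [pow_succ 2 n, pow_mul]

theorem DD_pow {r : ℝ} (hr : r ≤ 1) {t : ℂ} (ht : t ∈ DD r) (n : ℕ) : t ^ 2 ^ n ∈ DD r := by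
  induction n with
  | zero => simpa using ht
  | succ n ih => rw [pow_succ, pow_mul]; exact DD_sq hr ih

theorem tendsto_pow_pow {t : ℂ} (ht : ‖t‖ < 1) : Tendsto (fun n : ℕ => t ^ 2 ^ n) atTop (𝓝 0) :=
  (tendsto_pow_atTop_nhds_zero_of_norm_lt_one ht).comp
    (tendsto_pow_atTop_atTop_of_one_lt (by norm_num))

noncomputable def fa (a u : ℂ) : ℂ := 2 * (u ^ 2 / (1 + 2 * u)) + a * (u ^ 2 / (1 + 2 * u)) ^ 2

namespace Sol
variable {a : ℂ} {r : ℝ} {τ θ : ℂ → ℂ}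

theorem cτ0 (S : Sol a r τ θ) : ContinuousAt τ 0 :=
  (S.dτ.differentiableAt (ball_mem_nhds _ S.rpos)).continuousAt

theorem sq_ne (S : Sol a r τ θ) {s : ℂ} (hs : s ∈ ball (0:ℂ) r) : τ s ^ 2 ≠ s := by
  intro h
  have key : ∀ n : ℕ, τ (s ^ 2 ^ n) ^ 2 = s ^ 2 ^ n ∧ s ^ 2 ^ n ∈ ball (0:ℂ) r := by
    intro n
    induction n with
    | zero => simpa using ⟨h, by simpa using hs⟩
    | succ n ih =>
      obtain ⟨h1, h2⟩ := ih
      have h4 := S.e4 _ h2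
      rw [h1] at h4
      have h5 : (1 + θ (s ^ 2 ^ n)) * (τ ((s ^ 2 ^ n) ^ 2) - s ^ 2 ^ n) = 0 := by
        linear_combination -h4
      have h6 := sub_eq_zero.1 ((mul_eq_zero.1 h5).resolve_left (S.nθ _ h2))
      rw [pow2s]
      exact ⟨by rw [h6], sq_mem_ball S.rle h2⟩
  have hn : ‖s‖ < 1 := by simp at hs; linarith [S.rle]
  have ht := tendsto_pow_pow hn
  have h1 : Tendsto (fun n : ℕ => τ (s ^ 2 ^ n) ^ 2) atTop (𝓝 (τ 0 ^ 2)) :=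
    (S.cτ0.tendsto.comp ht).pow 2
  have h2 : Tendsto (fun n : ℕ => τ (s ^ 2 ^ n) ^ 2) atTop (𝓝 0) := by
    simpa only [(key _).1] using ht
  have := tendsto_nhds_unique h1 h2
  rw [S.τ0] at this
  norm_num at this

theorem den_ne (S : Sol a r τ θ) {t : ℂ} (ht : t ∈ DD r) : τ (t ^ 2) - t ≠ 0 := by
  intro h
  exact S.sq_ne (mem_DD.1 ht) (by rw [sub_eq_zero.1 h])

theorem den_ne' (S : Sol a r τ θ) {t : ℂ} (ht : t ∈ DD r) : τ (t ^ 2) + t ≠ 0 := by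
  intro h
  refine S.sq_ne (mem_DD.1 ht) ?_
  rw [eq_neg_of_add_eq_zero_left h]; ring

theorem dτ2 (S : Sol a r τ θ) : DifferentiableOn ℂ (fun t => τ (t ^ 2)) (DD r) :=
  S.dτ.comp (f := fun t : ℂ => t ^ 2) (by fun_prop) (fun _ ht => mem_DD.1 ht)

theorem dx (S : Sol a r τ θ) : DifferentiableOn ℂ (xf τ) (DD r) :=
  DifferentiableOn.div (by fun_prop) (S.dτ2.sub (by fun_prop)) (fun _ ht => S.den_ne ht)

theorem one_two (S : Sol a r τ θ) {t : ℂ} (ht : t ∈ DD r) : 1 + 2 * xf τ t ≠ 0 := by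
  have h1 := S.den_ne ht
  have h2 := S.den_ne' ht
  have : 1 + 2 * xf τ t = (τ (t ^ 2) + t) / (τ (t ^ 2) - t) := by
    unfold xf; field_simp; ring
  rw [this]
  exact div_ne_zero h2 h1

theorem theta_sq (S : Sol a r τ θ) {s : ℂ} (hs : s ∈ ball (0:ℂ) r) : θ s ^ 2 = 1 + a * xf τ s := by
  have h1 := S.den_ne (ball_sub_DD S.rle hs)
  have := S.e3 s hs
  unfold xf
  field_simp
  linear_combination this

theorem p_x (S : Sol a r τ θ) {t : ℂ} (ht : t ∈ DD r) :
    xf τ t ^ 2 / (1 + 2 * xf τ t) = xf τ (t ^ 2) / (1 + θ (t ^ 2)) := by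
  have h0 := S.one_two ht
  have h1 := S.den_ne ht
  have h2 := S.den_ne' ht
  have hs := mem_DD.1 ht
  have h3 := S.den_ne (ball_sub_DD S.rle hs)
  have h4 := S.nθ _ hs
  have h5 := S.e4 _ hs
  rw [div_eq_div_iff h0 h4]
  have e : 1 + 2 * xf τ t = (τ (t ^ 2) + t) / (τ (t ^ 2) - t) := by
    unfold xf; field_simp; ring
  rw [e]
  unfold xf
  rw [div_pow, div_mul_eq_mul_div, div_mul_div_comm, div_eq_div_iff (by positivity) (mul_ne_zero h3 h1)]
  linear_combination (-(t^2*(τ (t^2) - t))) * h5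

theorem f_x (S : Sol a r τ θ) {t : ℂ} (ht : t ∈ DD r) : fa a (xf τ t) = xf τ (t ^ 2) := by
  have hs := mem_DD.1 ht
  have h4 := S.nθ _ hs
  have := S.theta_sq hs
  unfold fa
  rw [S.p_x ht]
  field_simp
  linear_combination (-xf τ (t ^ 2)) * this

theorem x_zero : xf τ 0 = 0 := by simp [xf]

theorem mem0 (S : Sol a r τ θ) : (0:ℂ) ∈ DD r := by simp [DD, S.rpos]

theorem hasDeriv0 (S : Sol a r τ θ) : HasDerivAt (xf τ) (1/2) 0 := by
  have h := ((hasDerivAt_id (0:ℂ)).div (c := id) (d := fun t => τ (t ^ 2) - t) (x := 0)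
    ((S.dτ2.differentiableAt ((DD_open r).mem_nhds S.mem0)).sub differentiableAt_id).hasDerivAt
    (S.den_ne S.mem0))
  have e : (1 * (τ (0 ^ 2) - 0) - id 0 * deriv ((fun t => τ (t ^ 2)) - id) 0) / (τ (0 ^ 2) - 0) ^ 2
      = 1 / 2 := by
    simp [S.τ0]; norm_num
  rw [e] at h
  exact h

theorem deriv0 (S : Sol a r τ θ) : deriv (xf τ) 0 = 1/2 := S.hasDeriv0.deriv

theorem x_pow (S : Sol a r τ θ) {t : ℂ} (ht : t ∈ DD r) (n : ℕ) : (fa a)^[n] (xf τ t) = xf τ (t ^ 2 ^ n) := by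
  induction n with
  | zero => simp
  | succ n ih =>
    rw [Function.iterate_succ_apply', ih, S.f_x (DD_pow S.rle ht n), pow2s]

theorem inj (S : Sol a r τ θ) : InjOn (xf τ) (DD r) := by
  have han : AnalyticAt ℂ (xf τ) 0 :=
    S.dx.analyticAt ((DD_open r).mem_nhds S.mem0)
  have hst := han.hasStrictDerivAt
  rw [S.deriv0] at hst
  have hloc : ∃ V ∈ 𝓝 (0:ℂ), InjOn (xf τ) V := by
    refine ⟨_, (hst.hasStrictFDerivAt_equiv (by norm_num)).toOpenPartialHomeomorph.open_source.mem_nhds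
      (hst.hasStrictFDerivAt_equiv (by norm_num)).mem_toOpenPartialHomeomorph_source, ?_⟩
    exact (hst.hasStrictFDerivAt_equiv (by norm_num)).toOpenPartialHomeomorph.injOn
  obtain ⟨V, hV, hinj⟩ := hloc
  have key : ∀ n : ℕ, ∀ t ∈ DD r, ∀ s ∈ DD r, xf τ t = xf τ s → t ^ 2 ^ n = s ^ 2 ^ n → t = s := by
    intro n
    induction n with
    | zero => intro t _ s _ _ h; simpa using h
    | succ n ih =>
      intro t ht s hs h h2
      have h3 : t ^ 2 = s ^ 2 := by
        refine ih _ (DD_sq S.rle ht) _ (DD_sq S.rle hs) ?_ ?_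
        · rw [← S.f_x ht, ← S.f_x hs, h]
        · rw [← pow_mul, ← pow_mul, ← pow_succ']; exact h2
      rcases sq_eq_sq_iff_eq_or_eq_neg.1 h3 with h4 | h4
      · exact h4
      · have n1 := S.den_ne ht
        have n2 := S.den_ne hs
        have n3 := S.nτ _ (mem_DD.1 hs)
        unfold xf at h
        rw [div_eq_div_iff n1 n2, h4, neg_sq] at h
        have : s * τ (s ^ 2) = 0 := by linear_combination (-1/2) * h
        have := (mul_eq_zero.1 this).resolve_right n3
        rw [h4, this]; simp
  intro t ht s hs h
  have t1 := (tendsto_pow_pow (norm_lt_one_of_DD S.rle ht)).eventually hV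
  have t2 := (tendsto_pow_pow (norm_lt_one_of_DD S.rle hs)).eventually hV
  obtain ⟨n, h1, h2⟩ := (t1.and t2).exists
  refine key n t ht s hs h (hinj h1 h2 ?_)
  rw [← S.x_pow ht, ← S.x_pow hs, h]

theorem deriv_ne (S : Sol a r τ θ) {t : ℂ} (ht : t ∈ DD r) : deriv (xf τ) t ≠ 0 := by
  intro h
  have key : ∀ n : ℕ, deriv (xf τ) (t ^ 2 ^ n) = 0 := by
    intro n
    induction n with
    | zero => simpa using h
    | succ n ih =>
      set s := t ^ 2 ^ n with hs
      have hsD : s ∈ DD r := DD_pow S.rle ht n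
      rw [pow2s, ← hs]
      have d1 : HasDerivAt (xf τ) 0 s := by
        rw [← ih]
        exact (S.dx.differentiableAt ((DD_open r).mem_nhds hsD)).hasDerivAt
      have d2 : HasDerivAt (xf τ) (deriv (xf τ) (s ^ 2)) (s ^ 2) :=
        (S.dx.differentiableAt ((DD_open r).mem_nhds (DD_sq S.rle hsD))).hasDerivAt
      have d3 : HasDerivAt (fun u => xf τ (u ^ 2)) (deriv (xf τ) (s ^ 2) * (2 * s)) s := by
        have := HasDerivAt.comp s (h₂ := xf τ) (h := fun u => u ^ 2) d2 (by simpa using hasDerivAt_pow 2 s)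
        exact this
      have d4 : DifferentiableAt ℂ (fa a) (xf τ s) := by
        have := S.one_two hsD
        unfold fa
        fun_prop (disch := assumption)
      have d5 : HasDerivAt (fun u => xf τ (u ^ 2)) (deriv (fa a) (xf τ s) * 0) s := by
        have := HasDerivAt.comp s (h₂ := fa a) (h := xf τ) d4.hasDerivAt d1
        refine this.congr_of_eventuallyEq ?_
        filter_upwards [(DD_open r).mem_nhds hsD] with u hu
        exact (S.f_x hu).symm
      have := d3.unique d5
      rw [mul_zero] at this
      rcases mul_eq_zero.1 this with h | h
      · exact h
      · have : s = 0 := by simpa using h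
        rw [this] at ih
        rw [S.deriv0] at ih
        norm_num at ih
  have hc : ContinuousAt (deriv (xf τ)) 0 :=
    ((S.dx.deriv (DD_open r)).differentiableAt ((DD_open r).mem_nhds S.mem0)).continuousAt
  have h1 := hc.tendsto.comp (tendsto_pow_pow (norm_lt_one_of_DD S.rle ht))
  have h2 : (deriv (xf τ) ∘ fun n : ℕ => t ^ 2 ^ n) = fun _ => 0 := funext key
  rw [h2, S.deriv0] at h1
  have := tendsto_nhds_unique h1 tendsto_const_nhds
  norm_num at this

end Sol

theorem Sol.agree {a : ℂ} {r r' : ℝ} {τ θ τ' θ' : ℂ → ℂ} (S : Sol a r τ θ) (S' : Sol a r' τ' θ')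
    {t : ℂ} (h : t ∈ ball (0:ℂ) r) (h' : t ∈ ball (0:ℂ) r') : τ t = τ' t := by
  have hm : 0 < min r r' := lt_min S.rpos S'.rpos
  have hs : ball (0:ℂ) (min r r') ⊆ ball 0 r := ball_subset_ball (min_le_left _ _)
  have hs' : ball (0:ℂ) (min r r') ⊆ ball 0 r' := ball_subset_ball (min_le_right _ _)
  have := ((S.dτ.mono hs).analyticOnNhd isOpen_ball).eqOn_of_preconnected_of_eventuallyEq
    ((S'.dτ.mono hs').analyticOnNhd isOpen_ball) (convex_ball _ _).isPreconnected
    (mem_ball_self hm) (S.germ.trans S'.germ.symm)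
  exact this (by simp at *; exact ⟨h, h'⟩)

theorem Sol.agree_x {a : ℂ} {r r' : ℝ} {τ θ τ' θ' : ℂ → ℂ} (S : Sol a r τ θ) (S' : Sol a r' τ' θ')
    {t : ℂ} (h : t ∈ DD r) (h' : t ∈ DD r') : xf τ t = xf τ' t := by
  unfold xf
  rw [S.agree S' (mem_DD.1 h) (mem_DD.1 h')]
end

section
open Filter Topology Set Metric

theorem root_diff {E : Type*} [NormedAddCommGroup E] [NormedSpace ℂ E] {g h : E → ℂ} {p : E}
    (hg : DifferentiableAt ℂ g p) (hh : ContinuousAt h p) (hs : ∀ᶠ q in 𝓝 p, h q ^ 2 = g q)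
    (h0 : h p ≠ 0) : DifferentiableAt ℂ h p := by
  have hp := hs.self_of_nhds
  have hc : ContinuousAt (fun q => h q / h p) p := hh.div_const _
  have h1 : ∀ᶠ q in 𝓝 p, h q / h p ∈ ball (1:ℂ) 1 :=
    hc (by simpa [h0] using ball_mem_nhds (1:ℂ) one_pos)
  have h2 : h =ᶠ[𝓝 p] fun q => h p * csq (g q / h p ^ 2) := by
    filter_upwards [hs, h1] with q hq hq1
    have hre : 0 < (h q / h p).re := by
      rw [mem_ball, dist_eq_norm] at hq1
      have := (Complex.abs_re_le_norm _).trans_lt hq1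
      rw [Complex.sub_re, Complex.one_re] at this
      linarith [(abs_lt.1 this).1]
    have e : csq (g q / h p ^ 2) ^ 2 = (h q / h p) ^ 2 := by
      rw [csq_sq, ← hq, div_pow]
    rcases sq_eq_sq_iff_eq_or_eq_neg.1 e with e | e
    · rw [e]; field_simp
    · have := csq_re (g q / h p ^ 2)
      rw [e, Complex.neg_re] at this
      linarith
  refine DifferentiableAt.congr_of_eventuallyEq ?_ h2
  refine DifferentiableAt.const_mul ?_ _
  refine DifferentiableAt.comp (g := csq) (f := fun q => g q / h p ^ 2) p (csq_diff ?_)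
    (by simp only [div_eq_mul_inv]; exact hg.mul_const _)
  rw [← hp, div_self (by positivity)]
  simp

theorem exists_root {a0 : ℂ} {δ ρ : ℝ} (hδ : 0 < δ) (hρ : 0 < ρ) {g : ℂ × ℂ → ℂ}
    (hg : DifferentiableOn ℂ g (ball a0 δ ×ˢ ball 0 ρ))
    (hne : ∀ p ∈ ball a0 δ ×ˢ ball (0:ℂ) ρ, g p ≠ 0) {c : ℂ} (hc : c ≠ 0)
    (h0 : ∀ a ∈ ball a0 δ, g (a, 0) = c ^ 2) :
    ∃ h : ℂ × ℂ → ℂ, DifferentiableOn ℂ h (ball a0 δ ×ˢ ball 0 ρ) ∧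
      (∀ p ∈ ball a0 δ ×ˢ ball (0:ℂ) ρ, h p ^ 2 = g p) ∧ ∀ a ∈ ball a0 δ, h (a, 0) = c := by
  set V : Set (ℂ × ℂ) := ball a0 δ ×ˢ ball 0 ρ with hV
  have hVo : IsOpen V := isOpen_ball.prod isOpen_ball
  have hVc : Convex ℝ V := (convex_ball _ _).prod (convex_ball _ _)
  have hm : (a0, (0:ℂ)) ∈ V := ⟨mem_ball_self hδ, mem_ball_self hρ⟩
  have hsc : IsSimplyConnected V := by
    have := hVc.contractibleSpace ⟨_, hm⟩
    exact (inferInstance : SimplyConnectedSpace V)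
  obtain ⟨h, hc1, hsq⟩ := Complex.exists_continuousOn_pow_eq hsc hVo hg.continuousOn
    (by rintro ⟨p, hp, h⟩; exact hne p hp h) two_ne_zero
  have key : ∀ h : ℂ × ℂ → ℂ, ContinuousOn h V → (∀ p, h p ^ 2 = g p) → h (a0, 0) = c →
      ∃ h : ℂ × ℂ → ℂ, DifferentiableOn ℂ h V ∧
      (∀ p ∈ V, h p ^ 2 = g p) ∧ ∀ a ∈ ball a0 δ, h (a, 0) = c := by
    intro h hc1 hsq hh
    refine ⟨h, ?_, fun p _ => hsq p, ?_⟩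
    · intro p hp
      refine (root_diff (hg.differentiableAt (hVo.mem_nhds hp))
        (hc1.continuousAt (hVo.mem_nhds hp)) (Eventually.of_forall hsq) ?_).differentiableWithinAt
      intro h0
      have := hsq p
      rw [h0] at this
      exact hne p hp (by rw [← this]; simp)
    · have := (convex_ball a0 δ).isPreconnected.eq_of_sq_eq (f := fun a => h (a, 0))
        (g := fun _ => c) (hc1.comp (by fun_prop) (fun a ha => ⟨ha, mem_ball_self hρ⟩))
        continuousOn_const (fun a ha => by simp [hsq, h0 a ha]) (fun _ => hc)
        (mem_ball_self hδ) hh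
      exact this
  have h1 : h (a0, 0) ^ 2 = c ^ 2 := by rw [hsq, h0 _ (mem_ball_self hδ)]
  rcases sq_eq_sq_iff_eq_or_eq_neg.1 h1 with e | e
  · exact key h hc1 hsq e
  · exact key (fun p => - h p) hc1.neg (fun p => by rw [neg_sq, hsq]) (by simp [e])

theorem tube {a0 : ℂ} {δ ρ ρ' : ℝ} (hδ : 0 < δ) (hρ : ρ' < ρ) {g : ℂ × ℂ → ℂ}
    (hg : ContinuousOn g (ball a0 δ ×ˢ ball 0 ρ)) (hne : ∀ t ∈ ball (0:ℂ) ρ, g (a0, t) ≠ 0) :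
    ∃ δ' > 0, δ' ≤ δ ∧ ∀ p ∈ ball a0 δ' ×ˢ closedBall (0:ℂ) ρ', g p ≠ 0 := by
  have hVo : IsOpen (ball a0 δ ×ˢ ball (0:ℂ) ρ) := isOpen_ball.prod isOpen_ball
  have := (isCompact_closedBall (0:ℂ) ρ').eventually_forall_of_forall_eventually (x₀ := a0)
    (P := fun a t => g (a, t) ≠ 0) (fun t ht => by
      have ht' : t ∈ ball (0:ℂ) ρ := closedBall_subset_ball hρ ht
      exact (hg.continuousAt (hVo.mem_nhds ⟨mem_ball_self hδ, ht'⟩)).eventually_ne (hne t ht'))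
  obtain ⟨ε, hε, h⟩ := Metric.eventually_nhds_iff_ball.1 this
  refine ⟨min ε δ, lt_min hε hδ, min_le_right _ _, ?_⟩
  rintro ⟨a, t⟩ ⟨ha, ht⟩
  exact h a (ball_subset_ball (min_le_left _ _) ha) t ht

structure Fam (a0 : ℂ) (δ r : ℝ) (τ θ : ℂ × ℂ → ℂ) : Prop where
  δpos : 0 < δ
  dτ : DifferentiableOn ℂ τ (ball a0 δ ×ˢ ball 0 r)
  dθ : DifferentiableOn ℂ θ (ball a0 δ ×ˢ ball 0 r)
  sol : ∀ a ∈ ball a0 δ, Sol a r (fun t => τ (a, t)) (fun t => θ (a, t))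

def JJ (a0 : ℂ) (r : ℝ) : Prop := ∃ δ τ θ, Fam a0 δ r τ θ

theorem Fam.self {a0 : ℂ} {δ r : ℝ} {τ θ : ℂ × ℂ → ℂ} (F : Fam a0 δ r τ θ) :
    Sol a0 r (fun t => τ (a0, t)) (fun t => θ (a0, t)) := F.sol a0 (mem_ball_self F.δpos)

theorem sol_loc {a : ℂ} {r : ℝ} (hr : 0 < r) (hr1 : r ≤ 1) (h : ∀ t ∈ ball (0:ℂ) r, (a, t) ∈ Omg) :
    Sol a r (fun t => tul (a, t)) (fun t => thl (a, t)) where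
  rpos := hr
  rle := hr1
  dτ := tul_diff.comp (f := fun t => (a, t)) (by fun_prop) h
  dθ := thl_diff.comp (f := fun t => (a, t)) (by fun_prop) h
  τ0 := tul_zero a
  θ0 := thl_zero a
  e3 := fun t ht => thl_sq (h t ht)
  e4 := fun t ht => tul_sq (h t ht)
  nτ := fun t ht => tul_ne (h t ht)
  nθ := fun t ht => (thl_ne (h t ht)).2
  germ := Eventually.of_forall fun _ => rfl

theorem JJ_init (a0 : ℂ) : ∃ r > 0, r < 1 ∧ JJ a0 r := by
  set r : ℝ := 1 / (200 * (2 + ‖a0‖)) with hr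
  have hr0 : 0 < r := by positivity
  have hr2 : r * (2 + ‖a0‖) = 1 / 200 := by rw [hr]; field_simp
  have hr1 : r < 1 := by nlinarith [norm_nonneg a0]
  have hsub : ball a0 1 ×ˢ ball (0:ℂ) r ⊆ Omg := by
    rintro ⟨a, t⟩ ⟨ha, ht⟩
    simp only [mem_ball, dist_eq_norm, sub_zero] at ha ht
    have : ‖a‖ ≤ ‖a0‖ + ‖a - a0‖ := by
      have := norm_add_le a0 (a - a0)
      simpa using this
    simp only [Omg, mem_ofPred_eq]
    nlinarith [norm_nonneg t, norm_nonneg a]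
  refine ⟨r, hr0, hr1, 1, tul, thl, one_pos, tul_diff.mono hsub, thl_diff.mono hsub, ?_⟩
  intro a ha
  exact sol_loc hr0 hr1.le (fun t ht => hsub ⟨ha, ht⟩)

noncomputable def XX (τ : ℂ × ℂ → ℂ) (p : ℂ × ℂ) : ℂ := p.2 / (τ (p.1, p.2 ^ 2) - p.2)

theorem Fam.dτ2 {a0 : ℂ} {δ r : ℝ} {τ θ : ℂ × ℂ → ℂ} (F : Fam a0 δ r τ θ) :
    DifferentiableOn ℂ (fun p : ℂ × ℂ => τ (p.1, p.2 ^ 2)) (ball a0 δ ×ˢ ball 0 (√r)) := by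
  refine F.dτ.comp (f := fun p : ℂ × ℂ => (p.1, p.2 ^ 2)) (by fun_prop) ?_
  rintro ⟨a, t⟩ ⟨ha, ht⟩
  rw [← DD_eq_ball F.self.rpos.le] at ht
  exact ⟨ha, mem_DD.1 ht⟩

theorem Fam.dX {a0 : ℂ} {δ r : ℝ} {τ θ : ℂ × ℂ → ℂ} (F : Fam a0 δ r τ θ) :
    DifferentiableOn ℂ (XX τ) (ball a0 δ ×ˢ ball 0 (√r)) := by
  intro p hp
  have h1 := F.dτ2.differentiableAt ((isOpen_ball.prod isOpen_ball).mem_nhds hp)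
  refine DifferentiableAt.differentiableWithinAt ?_
  have h2 : τ (p.1, p.2 ^ 2) - p.2 ≠ 0 := by
    refine (F.sol p.1 hp.1).den_ne ?_
    rw [DD_eq_ball F.self.rpos.le]
    exact hp.2
  have key : ∀ G : ℂ × ℂ → ℂ, DifferentiableAt ℂ G p → G p - p.2 ≠ 0 →
      DifferentiableAt ℂ (fun p => p.2 / (G p - p.2)) p := by
    intro G h1 h2
    fun_prop (disch := assumption)
  exact key _ h1 h2

theorem JJ_step {a0 : ℂ} {δ r : ℝ} {τ θ : ℂ × ℂ → ℂ} (F : Fam a0 δ r τ θ)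
    (H1 : ∀ t ∈ DD r, 1 + a0 * xf (fun t => τ (a0, t)) t ≠ 0)
    (H2 : ∀ t ∈ DD r, t ≠ 0 → xf (fun t => τ (a0, t)) t ≠ a0 - 2)
    {r' : ℝ} (hr' : 0 < r') (hr : r' < √r) : JJ a0 r' := by
  have hr0 := F.self.rpos
  have hr1 : √r ≤ 1 := Real.sqrt_le_one.2 F.self.rle
  obtain ⟨r1, h1, h2⟩ := exists_between hr
  have hball : ∀ {t : ℂ}, t ∈ ball (0:ℂ) (√r) → t ∈ DD r := fun {t} h => by
    rwa [DD_eq_ball hr0.le]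
  -- first root
  have dg1 : DifferentiableOn ℂ (fun p : ℂ × ℂ => 1 + p.1 * XX τ p) (ball a0 δ ×ˢ ball 0 (√r)) := by
    have := F.dX
    fun_prop
  obtain ⟨δ1, hδ1, hδ1', hne1⟩ := tube F.δpos h2 dg1.continuousOn (fun t ht => H1 t (hball ht))
  have sub1 : ball a0 δ1 ×ˢ ball (0:ℂ) r1 ⊆ ball a0 δ ×ˢ ball 0 (√r) :=
    prod_mono (ball_subset_ball hδ1') (ball_subset_ball h2.le)
  obtain ⟨θ1, dθ1, sθ1, zθ1⟩ := exists_root hδ1 (hr'.trans h1) (dg1.mono sub1)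
    (fun p hp => hne1 p ⟨hp.1, ball_subset_closedBall hp.2⟩) (c := 1) one_ne_zero
    (fun a ha => by simp [XX])
  -- nonvanishing at a0
  have hxne : ∀ t ∈ DD r, t ≠ 0 → xf (fun t => τ (a0, t)) t ≠ 0 := fun t ht h0 =>
    div_ne_zero h0 (F.self.den_ne ht)
  have A1 : ∀ t ∈ ball (0:ℂ) r1, 1 + θ1 (a0, t) ≠ 0 := by
    intro t ht h
    have htD := hball (ball_subset_ball h2.le ht)
    have hs := sθ1 (a0, t) ⟨mem_ball_self hδ1, ht⟩
    have e : θ1 (a0, t) = -1 := by linear_combination h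
    by_cases ha : a0 = 0
    · have := (convex_ball (0:ℂ) r1).isPreconnected.eq_of_sq_eq (f := fun t => θ1 (a0, t))
        (g := fun _ => 1) (dθ1.continuousOn.comp (by fun_prop)
          (fun t ht => ⟨mem_ball_self hδ1, ht⟩)) continuousOn_const
        (fun t ht => by
          have := sθ1 (a0, t) ⟨mem_ball_self hδ1, ht⟩
          simp only [Pi.pow_apply]
          rw [this]
          simp [ha]) (fun _ => one_ne_zero)
        (mem_ball_self (hr'.trans h1)) (zθ1 a0 (mem_ball_self hδ1)) ht
      simp only [e] at this
      norm_num at this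
    · by_cases h0 : t = 0
      · rw [h0, zθ1 a0 (mem_ball_self hδ1)] at e
        norm_num at e
      · rw [e] at hs
        have : a0 * XX τ (a0, t) = 0 := by linear_combination -hs
        exact hxne t htD h0 ((mul_eq_zero.1 this).resolve_left ha)
  have A2 : ∀ t ∈ ball (0:ℂ) r1, 1 + θ1 (a0, t) + XX τ (a0, t) ≠ 0 := by
    intro t ht h
    have htD := hball (ball_subset_ball h2.le ht)
    have hs := sθ1 (a0, t) ⟨mem_ball_self hδ1, ht⟩
    have e : θ1 (a0, t) = -1 - XX τ (a0, t) := by linear_combination h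
    by_cases h0 : t = 0
    · rw [h0, zθ1 a0 (mem_ball_self hδ1)] at h
      simp [XX] at h
    · rw [e] at hs
      have : XX τ (a0, t) * (XX τ (a0, t) - (a0 - 2)) = 0 := by linear_combination hs
      exact H2 t htD h0 (sub_eq_zero.1 ((mul_eq_zero.1 this).resolve_left (hxne t htD h0)))
  have dX1 := F.dX.mono sub1
  have dA1 : DifferentiableOn ℂ (fun p => 1 + θ1 p) (ball a0 δ1 ×ˢ ball 0 r1) := by fun_prop
  have dA2 : DifferentiableOn ℂ (fun p => 1 + θ1 p + XX τ p) (ball a0 δ1 ×ˢ ball 0 r1) := by fun_prop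
  obtain ⟨δ2, hδ2, hδ2', hne2⟩ := tube hδ1 h1 dA1.continuousOn A1
  obtain ⟨δ3, hδ3, hδ3', hne3⟩ := tube hδ1 h1 dA2.continuousOn A2
  set ε := min δ2 δ3 with hε
  have hε0 : 0 < ε := lt_min hδ2 hδ3
  have sub2 : ball a0 ε ×ˢ ball (0:ℂ) r' ⊆ ball a0 δ1 ×ˢ ball 0 r1 :=
    prod_mono (ball_subset_ball ((min_le_left _ _).trans hδ2')) (ball_subset_ball h1.le)
  have sub3 := sub2.trans sub1
  have dτ2 := F.dτ2.mono sub3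
  have dθ2 := dθ1.mono sub2
  have dg2 : DifferentiableOn ℂ (fun p : ℂ × ℂ => (1 + θ1 p) * (τ (p.1, p.2 ^ 2) - p.2) + p.2)
      (ball a0 ε ×ˢ ball 0 r') :=
    ((dθ2.const_add 1).mul (dτ2.sub differentiableOn_snd)).add differentiableOn_snd
  obtain ⟨τ1, dτ1, sτ1, zτ1⟩ := exists_root hε0 hr' dg2 (fun p hp => by
      have hn := hne3 p ⟨ball_subset_ball (min_le_right _ _) hp.1, ball_subset_closedBall hp.2⟩
      have hd := (F.sol p.1 (sub3 hp).1).den_ne (hball (sub3 hp).2)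
      have e : (1 + θ1 p) * (τ (p.1, p.2 ^ 2) - p.2) + p.2 =
        (1 + θ1 p + XX τ p) * (τ (p.1, p.2 ^ 2) - p.2) := by
        rw [add_mul (1 + θ1 p), XX, div_mul_cancel₀ _ hd]
      rw [e]
      exact mul_ne_zero hn hd) (c := 2) two_ne_zero
    (fun a ha => by
      have := (sub3 (⟨ha, mem_ball_self hr'⟩ : (a, (0:ℂ)) ∈ ball a0 ε ×ˢ ball (0:ℂ) r')).1
      have h0 := (F.sol a this).τ0
      have h1 := zθ1 a (sub2 (⟨ha, mem_ball_self hr'⟩ : (a, (0:ℂ)) ∈ ball a0 ε ×ˢ ball (0:ℂ) r')).1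
      simp [h0, h1]; norm_num)
  refine ⟨ε, τ1, θ1, hε0, dτ1, dθ2, ?_⟩
  intro a ha
  have haδ : a ∈ ball a0 δ := (sub3 (⟨ha, mem_ball_self hr'⟩ : (a, (0:ℂ)) ∈ ball a0 ε ×ˢ ball (0:ℂ) r')).1
  have ha1 : a ∈ ball a0 δ1 := (sub2 (⟨ha, mem_ball_self hr'⟩ : (a, (0:ℂ)) ∈ ball a0 ε ×ˢ ball (0:ℂ) r')).1
  have S := F.sol a haδ
  have hm : 0 < min r r' := lt_min hr0 hr'
  have subr : ball (0:ℂ) (min r r') ⊆ ball 0 r := ball_subset_ball (min_le_left _ _)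
  have subr' : ball (0:ℂ) (min r r') ⊆ ball 0 r' := ball_subset_ball (min_le_right _ _)
  have sθ : ∀ t ∈ ball (0:ℂ) r', θ1 (a, t) ^ 2 = 1 + a * xf (fun t => τ (a, t)) t := fun t ht =>
    sθ1 (a, t) (sub2 ⟨ha, ht⟩)
  have sτ : ∀ t ∈ ball (0:ℂ) r', τ1 (a, t) ^ 2 = (1 + θ1 (a, t)) * (τ (a, t ^ 2) - t) + t :=
    fun t ht => sτ1 (a, t) ⟨ha, ht⟩
  have dθa : DifferentiableOn ℂ (fun t => θ1 (a, t)) (ball 0 r') :=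
    dθ2.comp (f := fun t => (a, t)) (by fun_prop) (fun t ht => ⟨ha, ht⟩)
  have dτa : DifferentiableOn ℂ (fun t => τ1 (a, t)) (ball 0 r') :=
    dτ1.comp (f := fun t => (a, t)) (by fun_prop) (fun t ht => ⟨ha, ht⟩)
  have aθ : EqOn (fun t => θ1 (a, t)) (fun t => θ (a, t)) (ball 0 (min r r')) := by
    refine (convex_ball (0:ℂ) _).isPreconnected.eq_of_sq_eq (dθa.continuousOn.mono subr')
      (S.dθ.continuousOn.mono subr) ?_ ?_ (mem_ball_self hm) ?_
    · intro t ht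
      simp only [Pi.pow_apply]
      rw [sθ t (subr' ht)]
      exact (S.theta_sq (subr ht)).symm
    · intro t ht h
      have := S.theta_sq (subr ht)
      rw [h] at this
      refine hne1 (a, t) ⟨ha1, ball_subset_closedBall (sub2 (⟨ha, subr' ht⟩ : (a, t) ∈ ball a0 ε ×ˢ ball (0:ℂ) r')).2⟩ ?_
      simp only
      rw [show XX τ (a, t) = xf (fun t => τ (a, t)) t from rfl, ← this]
      norm_num
    · simp only [zθ1 a ha1]
      exact S.θ0.symm
  have aτ : EqOn (fun t => τ1 (a, t)) (fun t => τ (a, t)) (ball 0 (min r r')) := by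
    refine (convex_ball (0:ℂ) _).isPreconnected.eq_of_sq_eq (dτa.continuousOn.mono subr')
      (S.dτ.continuousOn.mono subr) ?_ ?_ (mem_ball_self hm) ?_
    · intro t ht
      simp only [Pi.pow_apply]
      have h3 : θ1 (a, t) = θ (a, t) := aθ ht
      rw [sτ t (subr' ht), h3]
      exact (S.e4 t (subr ht)).symm
    · exact fun {t} ht => S.nτ t (subr ht)
    · simp only [zτ1 a ha]
      exact S.τ0.symm
  have hsq : ∀ t ∈ ball (0:ℂ) r', τ1 (a, t ^ 2) = τ (a, t ^ 2) := by
    intro t ht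
    refine aτ (x := t ^ 2) ?_
    have h5 := mem_DD.1 (hball (sub3 (⟨ha, ht⟩ : (a, t) ∈ ball a0 ε ×ˢ ball (0:ℂ) r')).2)
    have h6 := sq_mem_ball (hr.le.trans hr1) ht
    rw [mem_ball] at *
    exact lt_min h5 h6
  have hxx : ∀ t ∈ ball (0:ℂ) r', τ (a, t ^ 2) - t ≠ 0 := fun t ht =>
    S.den_ne (hball (sub3 (⟨ha, ht⟩ : (a, t) ∈ ball a0 ε ×ˢ ball (0:ℂ) r')).2)
  refine ⟨hr', hr.le.trans hr1, dτa, dθa, zτ1 a ha, zθ1 a ha1, ?_, ?_, ?_, ?_, ?_⟩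
  · intro t ht
    have := hxx t ht
    simp only [hsq t ht, sθ t ht, xf]
    field_simp
  · intro t ht
    simp only [hsq t ht, sτ t ht]
  · intro t ht h
    have hn := hne3 (a, t) ⟨ball_subset_ball (min_le_right _ _) ha, ball_subset_closedBall ht⟩
    have hd := hxx t ht
    have := sτ t ht
    have e : (1 + θ1 (a, t)) * (τ (a, t ^ 2) - t) + t =
        (1 + θ1 (a, t) + XX τ (a, t)) * (τ (a, t ^ 2) - t) := by
      rw [add_mul (1 + θ1 (a, t)), XX, div_mul_cancel₀ _ hd]
    rw [h, e] at this
    exact mul_ne_zero hn hd (by rw [← this]; norm_num)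
  · intro t ht
    exact hne2 (a, t) ⟨ball_subset_ball (min_le_left _ _) ha, ball_subset_closedBall ht⟩
  · refine EventuallyEq.trans ?_ S.germ
    filter_upwards [ball_mem_nhds (0:ℂ) hm] with t ht using aτ ht
end

section
open Filter Topology Set Metric OnePoint

def Never (a : ℂ) : Prop := ∀ δ r τ θ, Fam a δ r τ θ → ∀ t ∈ DD r,
  1 + a * xf (fun t => τ (a, t)) t ≠ 0 ∧ (t ≠ 0 → xf (fun t => τ (a, t)) t ≠ a - 2)

theorem JJ_all {a : ℂ} (h : Never a) {r : ℝ} (hr : 0 < r) (hr1 : r < 1) : JJ a r := by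
  obtain ⟨r0, h0, h1, hJ⟩ := JJ_init a
  have step : ∀ s, JJ a s → ∀ r', 0 < r' → r' < √s → JJ a r' := by
    rintro s ⟨δ, τ, θ, F⟩ r' h1 h2
    exact JJ_step F (fun t ht => (h _ _ _ _ F t ht).1) (fun t ht => (h _ _ _ _ F t ht).2) h1 h2
  have hn : ∀ n : ℕ, JJ a (r0 ^ ((3/4 : ℝ) ^ n)) := by
    intro n
    induction n with
    | zero => simpa using hJ
    | succ n ih =>
      refine step _ ih _ (by positivity) ?_
      rw [Real.sqrt_eq_rpow, ← Real.rpow_mul h0.le]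
      refine Real.rpow_lt_rpow_of_exponent_gt h0 h1 ?_
      rw [pow_succ]
      have : (0:ℝ) < (3/4) ^ n := by positivity
      linarith
  have ht : Tendsto (fun n : ℕ => r0 ^ ((3/4 : ℝ) ^ n)) atTop (𝓝 1) := by
    have h2 := tendsto_pow_atTop_nhds_zero_of_lt_one (r := (3/4:ℝ)) (by norm_num) (by norm_num)
    have h3 : Tendsto (fun y : ℝ => r0 ^ y) (𝓝 0) (𝓝 (r0 ^ (0:ℝ))) :=
      (Real.continuousAt_const_rpow h0.ne').tendsto
    rw [Real.rpow_zero] at h3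
    exact h3.comp h2
  obtain ⟨n, hn2⟩ := (ht.eventually (lt_mem_nhds hr1)).exists
  refine step _ (hn n) r hr (hn2.trans_le ?_)
  have l0 : 0 < r0 ^ ((3/4 : ℝ) ^ n) := by positivity
  have l1 : r0 ^ ((3/4 : ℝ) ^ n) ≤ 1 := Real.rpow_le_one h0.le h1.le (by positivity)
  refine Real.le_sqrt_of_sq_le ?_
  nlinarith

/-- inversion on the sphere -/
noncomputable def iot : OnePoint ℂ → OnePoint ℂ := fun z =>
  match z with
  | ∞ => ((0 : ℂ) : OnePoint ℂ)
  | (w : ℂ) => if w = 0 then ∞ else ((w⁻¹ : ℂ) : OnePoint ℂ)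

noncomputable def sinv (u : ℂ) : OnePoint ℂ := if u = 0 then ∞ else ((u⁻¹ : ℂ) : OnePoint ℂ)

theorem iot_coe (u : ℂ) : iot u = sinv u := rfl
theorem iot_inf : iot ∞ = ((0 : ℂ) : OnePoint ℂ) := rfl
theorem sinv_zero : sinv 0 = ∞ := by simp [sinv]
theorem sinv_ne {u : ℂ} (h : u ≠ 0) : sinv u = ((u⁻¹ : ℂ) : OnePoint ℂ) := by simp [sinv, h]

theorem iot_iot (z : OnePoint ℂ) : iot (iot z) = z := by
  induction z using OnePoint.rec with
  | infty => rw [iot_inf, iot_coe, sinv_zero]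
  | coe u =>
    rw [iot_coe]
    by_cases h : u = 0
    · rw [h, sinv_zero, iot_inf]
    · rw [sinv_ne h, iot_coe, sinv_ne (inv_ne_zero h), inv_inv]

theorem sinv_cont : Continuous sinv := by
  rw [continuous_iff_continuousAt]
  intro u
  by_cases h : u = 0
  · subst h
    rw [ContinuousAt, sinv_zero, ← nhdsNE_sup_pure, tendsto_sup]
    constructor
    · have h1 : Tendsto (fun u : ℂ => ((u⁻¹ : ℂ) : OnePoint ℂ)) (𝓝[≠] 0) (𝓝 ∞) := by
        have := (OnePoint.tendsto_coe_infty (X := ℂ)).comp (by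
          rw [Filter.coclosedCompact_eq_cocompact, ← Metric.cobounded_eq_cocompact]
          exact tendsto_inv₀_nhdsNE_zero)
        exact this
      refine h1.congr' ?_
      filter_upwards [self_mem_nhdsWithin] with u hu
      rw [sinv_ne hu]
    · rw [tendsto_pure_left]
      intro s hs
      rw [sinv_zero]
      exact mem_of_mem_nhds hs
  · have : ContinuousAt (fun u : ℂ => ((u⁻¹ : ℂ) : OnePoint ℂ)) u :=
      OnePoint.continuous_coe.continuousAt.comp (continuousAt_inv₀ h)
    refine this.congr ?_
    filter_upwards [isOpen_ne.mem_nhds h] with v hv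
    rw [sinv_ne hv]

theorem iot_cont : Continuous iot := by
  rw [continuous_iff_continuousAt]
  intro z
  induction z using OnePoint.rec with
  | infty =>
    rw [OnePoint.continuousAt_infty', iot_inf, Filter.coclosedCompact_eq_cocompact,
      ← Metric.cobounded_eq_cocompact]
    have h1 : Tendsto (fun u : ℂ => ((u⁻¹ : ℂ) : OnePoint ℂ)) (Bornology.cobounded ℂ)
        (𝓝 ((0:ℂ) : OnePoint ℂ)) :=
      (OnePoint.continuous_coe.tendsto 0).comp tendsto_inv₀_cobounded
    refine h1.congr' ?_
    filter_upwards [Bornology.eventually_ne_cobounded 0] with u hu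
    rw [Function.comp, iot_coe, sinv_ne hu]
  | coe u =>
    rw [OnePoint.continuousAt_coe]
    exact sinv_cont.continuousAt

noncomputable def iotH : OnePoint ℂ ≃ₜ OnePoint ℂ where
  toFun := iot
  invFun := iot
  left_inv := iot_iot
  right_inv := iot_iot
  continuous_toFun := iot_cont
  continuous_invFun := iot_cont

theorem sinv_emb : IsOpenEmbedding sinv :=
  iotH.isOpenEmbedding.comp OnePoint.isOpenEmbedding_coe

theorem Rhat_coe {a : ℂ} (ha : a ≠ 0) (w : ℂ) : Rhat a (w : OnePoint ℂ) = sinv ((w ^ 2 + 2 * w) / a) := by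
  change (if w ^ 2 + 2 * w = 0 then ∞ else ((a / (w ^ 2 + 2 * w) : ℂ) : OnePoint ℂ)) = _
  by_cases h : w ^ 2 + 2 * w = 0
  · simp [h, sinv_zero]
  · rw [if_neg h, sinv_ne (div_ne_zero h ha), inv_div]

theorem Rhat_inf (a : ℂ) : Rhat a ∞ = ((0 : ℂ) : OnePoint ℂ) := rfl

theorem Rhat_sinv (a : ℂ) {u : ℂ} (hu : 1 + 2 * u ≠ 0) :
    Rhat a (sinv u) = ((a * (u ^ 2 / (1 + 2 * u)) : ℂ) : OnePoint ℂ) := by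
  by_cases h : u = 0
  · rw [h, sinv_zero, Rhat_inf]; simp
  · rw [sinv_ne h]
    change (if u⁻¹ ^ 2 + 2 * u⁻¹ = 0 then ∞ else ((a / (u⁻¹ ^ 2 + 2 * u⁻¹) : ℂ) : OnePoint ℂ)) = _
    have e : u⁻¹ ^ 2 + 2 * u⁻¹ = (1 + 2 * u) / u ^ 2 := by field_simp
    rw [e, if_neg (div_ne_zero hu (by positivity))]
    congr 1
    field_simp

theorem Rhat2_sinv {a : ℂ} (ha : a ≠ 0) {u : ℂ} (hu : 1 + 2 * u ≠ 0) :
    Rhat a (Rhat a (sinv u)) = sinv (fa a u) := by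
  rw [Rhat_sinv a hu, Rhat_coe ha]
  congr 1
  unfold fa
  field_simp
  ring

theorem Rhat_joint {a0 : ℂ} (ha : a0 ≠ 0) (z : OnePoint ℂ) :
    ContinuousAt (fun p : ℂ × OnePoint ℂ => Rhat p.1 p.2) (a0, z) := by
  induction z using OnePoint.rec with
  | infty =>
    have hemb : IsOpenEmbedding (Prod.map id sinv : ℂ × ℂ → ℂ × OnePoint ℂ) :=
      IsOpenEmbedding.id.prodMap sinv_emb
    have := hemb.continuousAt_iff (g := fun p : ℂ × OnePoint ℂ => Rhat p.1 p.2) (x := (a0, 0))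
    simp only [Prod.map_apply, id, sinv_zero] at this
    rw [← this]
    have hc : ContinuousAt (fun p : ℂ × ℂ => ((p.1 * (p.2 ^ 2 / (1 + 2 * p.2)) : ℂ) : OnePoint ℂ))
        (a0, 0) := by
      refine OnePoint.continuous_coe.continuousAt.comp
        (f := fun p : ℂ × ℂ => p.1 * (p.2 ^ 2 / (1 + 2 * p.2))) ?_
      have : 1 + 2 * (a0, (0:ℂ)).2 ≠ 0 := by simp
      fun_prop (disch := assumption)
    refine hc.congr ?_
    have : ∀ᶠ p : ℂ × ℂ in 𝓝 (a0, 0), 1 + 2 * p.2 ≠ 0 :=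
      ContinuousAt.eventually_ne (by fun_prop) (by simp)
    filter_upwards [this] with p hp
    exact (Rhat_sinv p.1 hp).symm
  | coe w =>
    have hemb : IsOpenEmbedding (Prod.map id (↑) : ℂ × ℂ → ℂ × OnePoint ℂ) :=
      IsOpenEmbedding.id.prodMap OnePoint.isOpenEmbedding_coe
    have := hemb.continuousAt_iff (g := fun p : ℂ × OnePoint ℂ => Rhat p.1 p.2) (x := (a0, w))
    simp only [Prod.map_apply, id] at this
    rw [← this]
    have hc : ContinuousAt (fun p : ℂ × ℂ => sinv ((p.2 ^ 2 + 2 * p.2) / p.1)) (a0, w) := by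
      refine sinv_cont.continuousAt.comp
        (f := fun p : ℂ × ℂ => (p.2 ^ 2 + 2 * p.2) / p.1) ?_
      fun_prop (disch := assumption)
    refine hc.congr ?_
    have : ∀ᶠ p : ℂ × ℂ in 𝓝 (a0, w), p.1 ≠ 0 :=
      ContinuousAt.eventually_ne (by fun_prop) ha
    filter_upwards [this] with p hp
    exact (Rhat_coe hp p.2).symm

theorem Rhat_cont {a : ℂ} (ha : a ≠ 0) : Continuous (Rhat a) := by
  rw [continuous_iff_continuousAt]
  intro z
  exact ContinuousAt.comp (f := fun z => (a, z)) (Rhat_joint ha z) (by fun_prop)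

theorem Rhat_iter_cont {a : ℂ} (ha : a ≠ 0) {z : ℂ → OnePoint ℂ} (hz : ContinuousAt z a) (n : ℕ) :
    ContinuousAt (fun b => (Rhat b)^[n] (z b)) a := by
  induction n with
  | zero => simpa using hz
  | succ n ih =>
    simp only [Function.iterate_succ_apply']
    exact ContinuousAt.comp (f := fun b => (b, (Rhat b)^[n] (z b))) (Rhat_joint ha _)
      (continuousAt_id.prodMk ih)

theorem fa_small {a u : ℂ} (hu : ‖u‖ * (8 * (1 + ‖a‖)) < 1) :
    1 + 2 * u ≠ 0 ∧ ‖fa a u‖ ≤ ‖u‖ / 2 := by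
  have hu8 : ‖u‖ < 1/8 := by nlinarith [norm_nonneg a, norm_nonneg u, mul_nonneg (norm_nonneg a) (norm_nonneg u)]
  have h1 : 3/4 ≤ ‖1 + 2 * u‖ := by
    have : ‖(1:ℂ)‖ ≤ ‖1 + 2 * u‖ + ‖2 * u‖ := by
      have := norm_sub_le (1 + 2 * u) (2 * u)
      simpa using this
    rw [norm_mul] at this
    simp at this
    linarith
  have hne : 1 + 2 * u ≠ 0 := norm_pos_iff.1 (by linarith)
  refine ⟨hne, ?_⟩
  set p := u ^ 2 / (1 + 2 * u) with hp
  have hpn : ‖p‖ ≤ 4/3 * ‖u‖ ^ 2 := by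
    rw [hp, norm_div, norm_pow, div_le_iff₀ (by linarith)]
    nlinarith [sq_nonneg ‖u‖]
  have h2 : ‖a‖ * ‖p‖ ≤ 1 := by
    have : ‖a‖ * ‖u‖ ≤ 1/8 := by nlinarith [norm_nonneg a, norm_nonneg u]
    calc ‖a‖ * ‖p‖ ≤ ‖a‖ * (4/3 * ‖u‖ ^ 2) := by gcongr
      _ = 4/3 * (‖a‖ * ‖u‖) * ‖u‖ := by ring
      _ ≤ 4/3 * (1/8) * (1/8) := by gcongr
      _ ≤ 1 := by norm_num
  calc ‖fa a u‖ ≤ ‖2 * p‖ + ‖a * p ^ 2‖ := norm_add_le _ _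
    _ = 2 * ‖p‖ + (‖a‖ * ‖p‖) * ‖p‖ := by simp; ring
    _ ≤ 2 * ‖p‖ + 1 * ‖p‖ := by gcongr
    _ ≤ 4 * ‖u‖ ^ 2 := by linarith
    _ ≤ ‖u‖ / 2 := by nlinarith [norm_nonneg u]

def basI (a : ℂ) : Set (OnePoint ℂ) := {z | Tendsto (fun n => (Rhat a)^[2 * n] z) atTop (𝓝 ∞)}
def bas0 (a : ℂ) : Set (OnePoint ℂ) :=
  {z | Tendsto (fun n => (Rhat a)^[2 * n] z) atTop (𝓝 ((0 : ℂ) : OnePoint ℂ))}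

theorem sphereBasin_eq (a : ℂ) : sphereBasin a = basI a ∪ bas0 a := rfl

theorem iter_two (a : ℂ) (n : ℕ) (z : OnePoint ℂ) :
    (Rhat a)^[2 * (n + 1)] z = Rhat a (Rhat a ((Rhat a)^[2 * n] z)) := by
  rw [show 2 * (n + 1) = 2 * n + 1 + 1 by ring, Function.iterate_succ_apply',
    Function.iterate_succ_apply']

/-- `sinv ∘ fa`-orbits -/
theorem iter_sinv {a : ℂ} (ha : a ≠ 0) {u : ℕ → ℂ} (h : ∀ n, 1 + 2 * u n ≠ 0)
    (hs : ∀ n, u (n + 1) = fa a (u n)) (n : ℕ) : (Rhat a)^[2 * n] (sinv (u 0)) = sinv (u n) := by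
  induction n with
  | zero => simp
  | succ n ih => rw [iter_two, ih, Rhat2_sinv ha (h n), hs]

theorem small_basI {a : ℂ} (ha : a ≠ 0) {u : ℂ} (hu : ‖u‖ * (8 * (1 + ‖a‖)) < 1) : sinv u ∈ basI a := by
  have hb : ∀ n : ℕ, ‖(fa a)^[n] u‖ ≤ ‖u‖ * (1/2) ^ n := by
    intro n
    induction n with
    | zero => simp
    | succ n ih =>
      rw [Function.iterate_succ_apply']
      have h1 : ‖(fa a)^[n] u‖ ≤ ‖u‖ :=
        ih.trans (mul_le_of_le_one_right (norm_nonneg _) (pow_le_one₀ (by norm_num) (by norm_num)))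
      have := (fa_small (a := a) (u := (fa a)^[n] u) (lt_of_le_of_lt (by gcongr) hu)).2
      rw [pow_succ]
      linarith
  have hne : ∀ n : ℕ, 1 + 2 * (fa a)^[n] u ≠ 0 := by
    intro n
    have h1 : ‖(fa a)^[n] u‖ ≤ ‖u‖ :=
        (hb n).trans (mul_le_of_le_one_right (norm_nonneg _) (pow_le_one₀ (by norm_num) (by norm_num)))
    exact (fa_small (a := a) (u := (fa a)^[n] u) (lt_of_le_of_lt (by gcongr) hu)).1
  have h2 := iter_sinv ha (u := fun n => (fa a)^[n] u) hne
    (fun n => Function.iterate_succ_apply' _ _ _)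
  have h3 : Tendsto (fun n => (fa a)^[n] u) atTop (𝓝 0) := by
    refine squeeze_zero_norm hb ?_
    simpa using (tendsto_pow_atTop_nhds_zero_of_lt_one (r := (1/2:ℝ)) (by norm_num) (by norm_num)).const_mul ‖u‖
  change Tendsto _ _ _
  have h4 := (sinv_cont.tendsto 0).comp h3
  rw [sinv_zero] at h4
  refine h4.congr (fun n => ?_)
  exact (h2 n).symm

theorem basI_iter {a : ℂ} {z : OnePoint ℂ} (k : ℕ) : (Rhat a)^[2 * k] z ∈ basI a ↔ z ∈ basI a := by
  have h : (fun n => (Rhat a)^[2 * n] ((Rhat a)^[2 * k] z)) = fun n => (Rhat a)^[2 * (n + k)] z := by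
    funext n
    rw [← Function.iterate_add_apply]; congr 1
    rw [mul_add]
  change Tendsto _ _ _ ↔ Tendsto _ _ _
  rw [h]
  exact tendsto_add_atTop_iff_nat (f := fun n => (Rhat a)^[2 * n] z) k

def smallU (a : ℂ) : Set (OnePoint ℂ) := sinv '' {u | ‖u‖ * (8 * (1 + ‖a‖)) < 1}

theorem smallU_open (a : ℂ) : IsOpen (smallU a) :=
  sinv_emb.isOpenMap _ (isOpen_lt (by fun_prop) (by fun_prop))

theorem smallU_mem (a : ℂ) : ∞ ∈ smallU a := ⟨0, by simp, sinv_zero⟩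

theorem basI_open {a : ℂ} (ha : a ≠ 0) : IsOpen (basI a) := by
  rw [isOpen_iff_mem_nhds]
  intro z hz
  have : ∀ᶠ n in atTop, (Rhat a)^[2 * n] z ∈ smallU a :=
    hz ((smallU_open a).mem_nhds (smallU_mem a))
  obtain ⟨n, hn⟩ := this.exists
  have ho : IsOpen ((Rhat a)^[2 * n] ⁻¹' smallU a) := (smallU_open a).preimage ((Rhat_cont ha).iterate _)
  filter_upwards [ho.mem_nhds hn] with w hw
  obtain ⟨u, hu, hu2⟩ := hw
  rw [← basI_iter n, ← hu2]
  exact small_basI ha hu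

theorem bas0_eq {a : ℂ} (ha : a ≠ 0) : bas0 a = Rhat a ⁻¹' basI a := by
  ext z
  have hcom : ∀ n, (Rhat a)^[2 * n] (Rhat a z) = Rhat a ((Rhat a)^[2 * n] z) := fun n => by
    rw [← Function.iterate_succ_apply, Function.iterate_succ_apply']
  constructor
  · intro h
    change Tendsto _ _ _
    have := ((Rhat_cont ha).tendsto _).comp (show Tendsto _ _ _ from h)
    rw [Rhat_coe ha] at this
    simp only [Function.comp_def] at this
    simp only [hcom]
    simpa [sinv_zero] using this
  · intro h
    have h1 : Tendsto (fun n => (Rhat a)^[2 * n] (Rhat a z)) atTop (𝓝 ∞) := h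
    have := ((Rhat_cont ha).tendsto _).comp h1
    rw [Rhat_inf] at this
    change Tendsto _ _ _
    rw [← tendsto_add_atTop_iff_nat 1]
    refine this.congr (fun n => ?_)
    rw [Function.comp, hcom, iter_two]

theorem bas0_open {a : ℂ} (ha : a ≠ 0) : IsOpen (bas0 a) := by
  rw [bas0_eq ha]; exact (basI_open ha).preimage (Rhat_cont ha)

theorem bas_disj (a : ℂ) : Disjoint (basI a) (bas0 a) := by
  rw [Set.disjoint_left]
  intro z h1 h2
  have := tendsto_nhds_unique (show Tendsto _ _ _ from h1) (show Tendsto _ _ _ from h2)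
  exact OnePoint.infty_ne_coe _ this

theorem inf_basI {a : ℂ} (ha : a ≠ 0) : ∞ ∈ basI a := by
  rw [← sinv_zero]; exact small_basI ha (by simp)

theorem Ainf_sub {a : ℂ} (ha : a ≠ 0) : Ainf a ⊆ basI a := by
  have hm : ∞ ∈ sphereBasin a := Or.inl (inf_basI ha)
  exact isPreconnected_connectedComponentIn.subset_left_of_subset_union (basI_open ha) (bas0_open ha)
    (bas_disj a) (by rw [← sphereBasin_eq]; exact connectedComponentIn_subset _ _)
    ⟨∞, mem_connectedComponentIn hm, inf_basI ha⟩

theorem Sol.iter {a : ℂ} (ha : a ≠ 0) {r : ℝ} {τ θ : ℂ → ℂ} (S : Sol a r τ θ) {t : ℂ} (ht : t ∈ DD r)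
    (n : ℕ) : (Rhat a)^[2 * n] (sinv (xf τ t)) = sinv (xf τ (t ^ 2 ^ n)) := by
  have := iter_sinv ha (u := fun n => xf τ (t ^ 2 ^ n)) (fun n => S.one_two (DD_pow S.rle ht n))
    (fun n => by simp only [pow2s]; rw [S.f_x (DD_pow S.rle ht n)]) n
  simpa using this

theorem Sol.basI {a : ℂ} (ha : a ≠ 0) {r : ℝ} {τ θ : ℂ → ℂ} (S : Sol a r τ θ) {t : ℂ} (ht : t ∈ DD r) :
    sinv (xf τ t) ∈ basI a := by
  change Tendsto _ _ _
  simp only [S.iter ha ht]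
  have hc : ContinuousAt (xf τ) 0 := S.hasDeriv0.continuousAt
  have := (sinv_cont.tendsto _).comp (hc.tendsto.comp (tendsto_pow_pow (norm_lt_one_of_DD S.rle ht)))
  rw [Sol.x_zero, sinv_zero] at this
  exact this

theorem C1 {a : ℂ} (ha : a ≠ 0) {r : ℝ} {τ θ : ℂ → ℂ} (S : Sol a r τ θ) {t : ℂ} (ht : t ∈ DD r)
    (h : 1 + a * xf τ t = 0) : a ∈ Pinf := by
  refine ⟨ha, ?_⟩
  have hx : xf τ t = -a⁻¹ := by field_simp; linear_combination h
  have e : sinv (xf τ t) = ((-a : ℂ) : OnePoint ℂ) := by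
    rw [hx, sinv_ne (by simpa using ha)]; simp
  have hpre : IsPreconnected ((sinv ∘ xf τ) '' DD r) := by
    refine IsPreconnected.image ?_ _ (sinv_cont.comp_continuousOn S.dx.continuousOn)
    rw [DD_eq_ball S.rpos.le]; exact (convex_ball _ _).isPreconnected
  have hsub : (sinv ∘ xf τ) '' DD r ⊆ sphereBasin a := by
    rintro _ ⟨s, hs, rfl⟩
    exact Or.inl (S.basI ha hs)
  rw [← e]
  exact hpre.subset_connectedComponentIn ⟨0, S.mem0, by simp [Sol.x_zero, sinv_zero]⟩ hsub
    ⟨t, ht, rfl⟩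

theorem C1' {a : ℂ} (ha : a ≠ 0) {r : ℝ} {τ θ : ℂ → ℂ} (S : Sol a r τ θ) {t : ℂ} (ht : t ∈ DD r)
    (h : xf τ t = a - 2) : ((-a : ℂ) : OnePoint ℂ) ∈ bas0 a := by
  rw [bas0_eq ha, mem_preimage, Rhat_coe ha]
  have : ((-a) ^ 2 + 2 * (-a)) / a = xf τ t := by rw [h]; field_simp; ring
  rw [this]
  exact S.basI ha ht

theorem C2 {a : ℂ} (hP : a ∈ Pinf) : ∃ δ r τ θ, Fam a δ r τ θ ∧
    ∃ t ∈ DD r, 1 + a * xf (fun t => τ (a, t)) t = 0 := by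
  by_contra hcon
  push Not at hcon
  obtain ⟨ha, hA⟩ := hP
  have hI : ((-a : ℂ) : OnePoint ℂ) ∈ basI a := Ainf_sub ha hA
  have hN : Never a := fun δ r τ θ F t ht => ⟨hcon δ r τ θ F t ht, fun _ h =>
    Set.disjoint_left.1 (bas_disj a) hI (C1' ha F.self ht h)⟩
  have hS : ∀ r : ℝ, 0 < r ∧ r < 1 → ∃ τ θ, Sol a r τ θ ∧ ∀ t ∈ DD r, 1 + a * xf τ t ≠ 0 := by
    rintro r ⟨h1, h2⟩
    obtain ⟨δ, τ, θ, F⟩ := JJ_all hN h1 h2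
    exact ⟨_, _, F.self, hcon _ _ _ _ F⟩
  choose! τ θ S hno using hS
  set rr : ℂ → ℝ := fun t => (1 + ‖t‖ ^ 2) / 2 with hrr
  set X : ℂ → ℂ := fun t => xf (τ (rr t)) t with hX
  have rr_mem : ∀ t : ℂ, ‖t‖ < 1 → 0 < rr t ∧ rr t < 1 ∧ t ∈ DD (rr t) := by
    intro t ht
    have : ‖t‖ ^ 2 < 1 := by nlinarith [norm_nonneg t]
    refine ⟨by positivity, by simp only [hrr]; linarith, ?_⟩
    change ‖t‖ ^ 2 < (1 + ‖t‖ ^ 2) / 2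
    linarith
  have hXe : ∀ r : ℝ, 0 < r → r < 1 → ∀ t ∈ DD r, X t = xf (τ r) t := by
    intro r h1 h2 t ht
    obtain ⟨k1, k2, k3⟩ := rr_mem t (norm_lt_one_of_DD h2.le ht)
    exact (S _ ⟨k1, k2⟩).agree_x (S r ⟨h1, h2⟩) k3 ht
  have hXs : ∀ t : ℂ, ‖t‖ < 1 → ∃ r τ θ, Sol a r τ θ ∧ t ∈ DD r ∧ (∀ s ∈ DD r, X s = xf τ s) ∧
      1 + a * X t ≠ 0 := by
    intro t ht
    obtain ⟨k1, k2, k3⟩ := rr_mem t ht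
    exact ⟨_, _, _, S _ ⟨k1, k2⟩, k3, hXe _ k1 k2, hno _ ⟨k1, k2⟩ t k3⟩
  have hXc : ContinuousOn X (ball 0 1) := by
    intro t ht
    obtain ⟨r, τ, θ, S, h1, h2, -⟩ := hXs t (by simpa using ht)
    refine ContinuousAt.continuousWithinAt ?_
    refine (S.dx.continuousOn.continuousAt ((DD_open r).mem_nhds h1)).congr ?_
    filter_upwards [(DD_open r).mem_nhds h1] with s hs using (h2 s hs).symm
  have hXo : ∀ U : Set ℂ, IsOpen U → U ⊆ ball 0 1 → IsOpen (X '' U) := by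
    intro U hU hU1
    rw [isOpen_iff_mem_nhds]
    rintro _ ⟨t, ht, rfl⟩
    obtain ⟨r, τ, θ, S, h1, h2, -⟩ := hXs t (by simpa using hU1 ht)
    have han : AnalyticAt ℂ (xf τ) t := S.dx.analyticAt ((DD_open r).mem_nhds h1)
    have hm := han.hasStrictDerivAt.map_nhds_eq (S.deriv_ne h1)
    rw [h2 t h1, ← hm]
    have : (X : ℂ → ℂ) =ᶠ[𝓝 t] xf τ := by
      filter_upwards [(DD_open r).mem_nhds h1] with s hs using h2 s hs
    rw [← Filter.map_congr this]
    exact image_mem_map (hU.mem_nhds ht)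
  have hXi : InjOn X (ball 0 1) := by
    intro t ht s hs h
    have ht : ‖t‖ < 1 := by simpa using ht
    have hs : ‖s‖ < 1 := by simpa using hs
    obtain ⟨ρ, h1, h2⟩ := exists_between (max_lt ht hs)
    have hρ : 0 < ρ := lt_of_le_of_lt (norm_nonneg t) ((le_max_left _ _).trans_lt h1)
    have t1 : t ∈ DD (ρ ^ 2) := by
      change ‖t‖ ^ 2 < ρ ^ 2
      have := (le_max_left _ _).trans_lt h1
      gcongr
    have s1 : s ∈ DD (ρ ^ 2) := by
      change ‖s‖ ^ 2 < ρ ^ 2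
      have := (le_max_right _ _).trans_lt h1
      gcongr
    have hρ2 : ρ ^ 2 < 1 := by nlinarith
    rw [hXe _ (by positivity) hρ2 t t1, hXe _ (by positivity) hρ2 s s1] at h
    exact (S _ ⟨by positivity, hρ2⟩).inj t1 s1 h
  have hXit : ∀ t : ℂ, ‖t‖ < 1 → ∀ n : ℕ, (Rhat a)^[2 * n] (sinv (X t)) = sinv (X (t ^ 2 ^ n)) := by
    intro t ht n
    obtain ⟨r, τ, θ, S, h1, h2, -⟩ := hXs t ht
    rw [h2 t h1, h2 _ (DD_pow S.rle h1 n)]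
    exact S.iter ha h1 n
  have hX0 : X 0 = 0 := by simp [hX, xf]
  set W := (fun t => sinv (X t)) '' ball 0 1 with hW
  have hWo : IsOpen W := by
    have : W = sinv '' (X '' ball 0 1) := by rw [hW, image_image]
    rw [this]
    exact sinv_emb.isOpenMap _ (hXo _ isOpen_ball subset_rfl)
  have hWcl : closure W ∩ basI a ⊆ W := by
    rintro z ⟨hz, hzI⟩
    set V := (fun t => sinv (X t)) '' ball 0 (1/2) with hV
    have hVo : IsOpen V := by
      have : V = sinv '' (X '' ball 0 (1/2)) := by rw [hV, image_image]
      rw [this]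
      exact sinv_emb.isOpenMap _ (hXo _ isOpen_ball (ball_subset_ball (by norm_num)))
    have hVm : ∞ ∈ V := ⟨0, by simp, by simp [hX0, sinv_zero]⟩
    have : ∀ᶠ n in atTop, (Rhat a)^[2 * n] z ∈ V :=
      (show Tendsto _ _ _ from hzI) (hVo.mem_nhds hVm)
    obtain ⟨n, hn⟩ := this.exists
    have ho : IsOpen ((Rhat a)^[2 * n] ⁻¹' V) := hVo.preimage ((Rhat_cont ha).iterate _)
    have hz2 : z ∈ closure (((Rhat a)^[2 * n] ⁻¹' V) ∩ W) := ho.inter_closure ⟨hn, hz⟩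
    set K : Set ℂ := {t | ‖t‖ ^ 2 ^ n ≤ 1/2} with hK
    have hK1 : K ⊆ ball 0 1 := by
      intro t ht
      have ht : ‖t‖ ^ 2 ^ n ≤ 1/2 := ht
      by_contra hc
      simp at hc
      have := one_le_pow₀ hc (n := 2 ^ n)
      linarith
    have hKc : IsCompact K := by
      refine Metric.isCompact_of_isClosed_isBounded (isClosed_le (by fun_prop) (by fun_prop)) ?_
      exact isBounded_ball.subset hK1
    have hKcl : IsClosed ((fun t => sinv (X t)) '' K) :=
      (hKc.image_of_continuousOn (sinv_cont.comp_continuousOn (hXc.mono hK1))).isClosed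
    have hsub : ((Rhat a)^[2 * n] ⁻¹' V) ∩ W ⊆ (fun t => sinv (X t)) '' K := by
      rintro _ ⟨h1, t, ht, rfl⟩
      refine ⟨t, ?_, rfl⟩
      have ht' : ‖t‖ < 1 := by simpa using ht
      obtain ⟨s, hs, hs2⟩ := h1
      rw [hXit t ht' n] at hs2
      have htn : t ^ 2 ^ n ∈ ball (0:ℂ) 1 := by
        simp only [mem_ball, dist_zero_right, norm_pow]
        exact pow_lt_one₀ (norm_nonneg _) ht' (by positivity)
      have := hXi (ball_subset_ball (by norm_num) hs) htn (sinv_emb.injective hs2)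
      rw [this] at hs
      simp only [mem_ball, dist_zero_right, norm_pow] at hs
      exact hs.le
    have := hKcl.closure_subset_iff.2 hsub hz2
    exact image_mono hK1 this
  have hAW : Ainf a ⊆ W := by
    refine isPreconnected_connectedComponentIn.subset_of_closure_inter_subset hWo
      ⟨∞, mem_connectedComponentIn (Or.inl (inf_basI ha)), ⟨0, by simp, by simp [hX0, sinv_zero]⟩⟩ ?_
    rintro z ⟨h1, h2⟩
    exact hWcl ⟨h1, Ainf_sub ha h2⟩
  obtain ⟨t, ht, h⟩ := hAW hA
  obtain ⟨r, τ', θ', S', h1, h2, h3⟩ := hXs t (by simpa using ht)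
  have e : sinv (-a⁻¹) = ((-a : ℂ) : OnePoint ℂ) := by
    rw [sinv_ne (by simpa using ha)]; simp
  have : X t = -a⁻¹ := sinv_emb.injective (h.trans e.symm)
  refine h3 ?_
  rw [this]
  field_simp
  ring
end

section
open Filter Topology Set Metric OnePoint

def Hit (a t : ℂ) : Prop := ∃ r τ θ, Sol a r τ θ ∧ t ∈ DD r ∧ 1 + a * xf τ t = 0

theorem Hit.unique {a t t' : ℂ} (h : Hit a t) (h' : Hit a t') : t = t' := by
  obtain ⟨r, τ, θ, S, h1, h2⟩ := h
  obtain ⟨r', τ', θ', S', h1', h2'⟩ := h'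
  have ha : a ≠ 0 := by rintro rfl; simp at h2
  rcases le_total r r' with hr | hr
  · have h3 : t ∈ DD r' := lt_of_lt_of_le (show ‖t‖ ^ 2 < r from h1) hr
    rw [S.agree_x S' h1 h3] at h2
    refine S'.inj h3 h1' (mul_left_cancel₀ ha ?_)
    linear_combination h2 - h2'
  · have h3 : t' ∈ DD r := lt_of_lt_of_le (show ‖t'‖ ^ 2 < r' from h1') hr
    rw [← S.agree_x S' h3 h1'] at h2'
    refine S.inj h1 h3 (mul_left_cancel₀ ha ?_)
    linear_combination h2 - h2'

theorem Hit.norm_lt {a t : ℂ} (h : Hit a t) : ‖t‖ < 1 := by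
  obtain ⟨r, τ, θ, S, h1, h2⟩ := h
  exact norm_lt_one_of_DD S.rle h1

theorem Hit.ne {a t : ℂ} (h : Hit a t) : t ≠ 0 := by
  obtain ⟨r, τ, θ, S, h1, h2⟩ := h
  rintro rfl
  simp [Sol.x_zero] at h2

theorem Hit.mem {a t : ℂ} (h : Hit a t) : a ∈ Pinf := by
  obtain ⟨r, τ, θ, S, h1, h2⟩ := h
  have ha : a ≠ 0 := by rintro rfl; simp at h2
  exact C1 ha S h1 h2

open Classical in
noncomputable def Phi (a : ℂ) : ℂ := if h : ∃ t, Hit a t then h.choose else 0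

theorem Hit.phi {a t : ℂ} (h : Hit a t) : Phi a = t := by
  have h' : ∃ t, Hit a t := ⟨t, h⟩
  rw [Phi, dif_pos h']
  exact h'.choose_spec.unique h

theorem hit_of_mem {a : ℂ} (h : a ∈ Pinf) : Hit a (Phi a) := by
  obtain ⟨δ, r, τ, θ, F, t, h1, h2⟩ := C2 h
  have : Hit a t := ⟨r, _, _, F.self, h1, h2⟩
  rwa [this.phi]

theorem imp_fun {U : Set (ℂ × ℂ)} (hU : IsOpen U) {g : ℂ × ℂ → ℂ} (hg : DifferentiableOn ℂ g U)
    {p : ℂ × ℂ} (hp : p ∈ U) (hd : deriv (fun t => g (p.1, t)) p.2 ≠ 0) (h0 : g p = 0) :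
    ∃ ψ : ℂ → ℂ, DifferentiableAt ℂ ψ p.1 ∧ Tendsto ψ (𝓝 p.1) (𝓝 p.2) ∧
      ∀ᶠ a in 𝓝 p.1, g (a, ψ a) = 0 := by
  have hs1 : ∀ p ∈ U, DifferentiableAt ℂ (fun t => g (p.1, t)) p.2 := fun p hp =>
    DifferentiableAt.comp (f := fun t => (p.1, t)) p.2 (hg.differentiableAt (hU.mem_nhds hp))
      (by fun_prop)
  have hs2 : ∀ p ∈ U, DifferentiableAt ℂ (fun a => g (a, p.2)) p.1 := fun p hp =>
    DifferentiableAt.comp (f := fun a => (a, p.2)) p.1 (hg.differentiableAt (hU.mem_nhds hp))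
      (by fun_prop)
  have hc := hg.continuousOn
  have c2 := contAt_partial hU hc hs1 hp
  have c1 : ContinuousAt (fun q : ℂ × ℂ => deriv (fun a => g (a, q.2)) q.1) p := by
    have hU' : IsOpen (Prod.swap ⁻¹' U) := hU.preimage continuous_swap
    have := contAt_partial (f := g ∘ Prod.swap) hU' (hc.comp continuous_swap.continuousOn
      (fun x hx => hx)) (fun q hq => hs2 _ hq) (p := p.swap) (by simpa using hp)
    exact ContinuousAt.comp (f := Prod.swap) (x := p) this continuous_swap.continuousAt
  set f₁ : ℂ → ℂ → ℂ →L[ℂ] ℂ :=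
    fun a t => ContinuousLinearMap.toSpanSingleton ℂ (deriv (fun a => g (a, t)) a) with hf₁
  set f₂ : ℂ → ℂ → ℂ →L[ℂ] ℂ :=
    fun a t => ContinuousLinearMap.toSpanSingleton ℂ (deriv (fun t => g (a, t)) t) with hf₂
  have df₁ : ∀ᶠ v in 𝓝 p, HasFDerivAt (fun a => g (a, v.2)) (f₁ v.1 v.2) v.1 := by
    filter_upwards [hU.mem_nhds hp] with v hv
    exact (hs2 v hv).hasDerivAt.hasFDerivAt
  have df₂ : ∀ᶠ v in 𝓝 p, HasFDerivAt (fun t => g (v.1, t)) (f₂ v.1 v.2) v.2 := by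
    filter_upwards [hU.mem_nhds hp] with v hv
    exact (hs1 v hv).hasDerivAt.hasFDerivAt
  have cf₁ : ContinuousAt ↿f₁ p :=
    (ContinuousLinearMap.toSpanSingletonCLE (𝕜 := ℂ) (E := ℂ)).continuous.continuousAt.comp c1
  have cf₂ : ContinuousAt ↿f₂ p :=
    (ContinuousLinearMap.toSpanSingletonCLE (𝕜 := ℂ) (E := ℂ)).continuous.continuousAt.comp c2
  have hinv : (f₂ p.1 p.2).IsInvertible := by
    refine ⟨ContinuousLinearEquiv.unitsEquivAut ℂ (Units.mk0 _ hd), ?_⟩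
    ext
    simp [hf₂]
  have e := eventually_apply_implicitFunctionOfBivariate (f := fun a t => g (a, t)) df₁ df₂ cf₁ cf₂ hinv
  refine ⟨implicitFunctionOfBivariate (f := fun a t => g (a, t)) df₁ df₂ cf₁ cf₂ hinv,
    (hasStrictFDerivAt_implicitFunctionOfBivariate (f := fun a t => g (a, t)) df₁ df₂ cf₁ cf₂ hinv).hasFDerivAt.differentiableAt,
    tendsto_implicitFunctionOfBivariate (f := fun a t => g (a, t)) df₁ df₂ cf₁ cf₂ hinv, ?_⟩
  filter_upwards [e] with a ha
  rw [ha]; exact h0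

theorem C4 {a0 : ℂ} (h : a0 ∈ Pinf) : Pinf ∈ 𝓝 a0 ∧ DifferentiableAt ℂ Phi a0 := by
  obtain ⟨δ, r, τ, θ, F, t, h1, h2⟩ := C2 h
  have ha : a0 ≠ 0 := h.1
  set U : Set (ℂ × ℂ) := ball a0 δ ×ˢ ball 0 (√r) with hU
  have hUo : IsOpen U := isOpen_ball.prod isOpen_ball
  have hp : (a0, t) ∈ U := by
    refine ⟨mem_ball_self F.δpos, ?_⟩
    rwa [← DD_eq_ball F.self.rpos.le]
  have hg : DifferentiableOn ℂ (fun p : ℂ × ℂ => 1 + p.1 * XX τ p) U := by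
    have := F.dX
    fun_prop
  have hd : deriv (fun t => 1 + a0 * XX τ (a0, t)) t ≠ 0 := by
    have e : (fun t => 1 + a0 * XX τ (a0, t)) = fun s => 1 + a0 * xf (fun t => τ (a0, t)) s := rfl
    have hx : HasDerivAt (xf (fun t => τ (a0, t))) _ t :=
      (F.self.dx.differentiableAt ((DD_open r).mem_nhds h1)).hasDerivAt
    rw [e, ((hx.const_mul a0).const_add 1).deriv]
    exact mul_ne_zero ha (F.self.deriv_ne h1)
  obtain ⟨ψ, d, ht, hz⟩ := imp_fun hUo hg hp hd h2
  have hm : ∀ᶠ a in 𝓝 a0, (a, ψ a) ∈ U :=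
    (tendsto_id.prodMk_nhds ht).eventually (hUo.mem_nhds hp)
  have hH : ∀ᶠ a in 𝓝 a0, Hit a (ψ a) := by
    filter_upwards [hm, hz] with a h3 h4
    refine ⟨r, _, _, F.sol a h3.1, ?_, h4⟩
    rw [DD_eq_ball F.self.rpos.le]
    exact h3.2
  constructor
  · filter_upwards [hH] with a h3 using h3.mem
  · refine d.congr_of_eventuallyEq ?_
    filter_upwards [hH] with a h3 using h3.phi

theorem never_zero : Never 0 := by
  intro δ r τ θ F t ht
  refine ⟨by simp, fun _ hx => ?_⟩
  have key : ∀ n : ℕ, ∃ y : ℝ, 2 ≤ y ∧ (fa 0)^[n] (-2) = -(y : ℂ) := by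
    intro n
    induction n with
    | zero => exact ⟨2, le_rfl, by simp⟩
    | succ n ih =>
      obtain ⟨y, hy, e⟩ := ih
      have hp : 0 < 2 * y - 1 := by linarith
      refine ⟨2 * y ^ 2 / (2 * y - 1), ?_, ?_⟩
      · rw [le_div_iff₀ hp]; nlinarith
      · rw [Function.iterate_succ_apply', e]
        have h1 : (2 * (y:ℂ) - 1) ≠ 0 := by
          have : ((2 * y - 1 : ℝ) : ℂ) ≠ 0 := by exact_mod_cast hp.ne'
          simpa using this
        have h2 : 1 + 2 * -(y:ℂ) ≠ 0 := by
          intro h; apply h1; linear_combination -h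
        have h3 : 1 + 2 * -(y:ℂ) = -(2 * (y:ℂ) - 1) := by ring
        unfold fa
        push_cast
        rw [h3, zero_mul, add_zero, neg_sq, div_neg, mul_neg, mul_div_assoc]
  have hc : ContinuousAt (xf (fun t => τ (0, t))) 0 := F.self.hasDeriv0.continuousAt
  have := hc.tendsto.comp (tendsto_pow_pow (norm_lt_one_of_DD F.self.rle ht))
  rw [Sol.x_zero] at this
  have h2 := this.norm
  rw [norm_zero] at h2
  obtain ⟨n, hn⟩ := (h2.eventually (gt_mem_nhds (zero_lt_two))).exists
  rw [Function.comp, ← F.self.x_pow ht, hx] at hn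
  obtain ⟨y, hy, e⟩ := key n
  rw [zero_sub, e, norm_neg, Complex.norm_real, Real.norm_eq_abs, abs_of_nonneg (by linarith)] at hn
  linarith

theorem bas0_near {a0 : ℂ} (ha : a0 ≠ 0) (h : ((-a0 : ℂ) : OnePoint ℂ) ∈ bas0 a0) :
    ∀ᶠ a in 𝓝 a0, a ∉ Pinf := by
  rw [bas0_eq ha] at h
  set U : Set (OnePoint ℂ) := sinv '' {u | ‖u‖ * (8 * (2 + ‖a0‖)) < 1} with hU
  have hUo : IsOpen U := sinv_emb.isOpenMap _ (isOpen_lt (by fun_prop) (by fun_prop))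
  have hUm : ∞ ∈ U := ⟨0, by simp, sinv_zero⟩
  have h1 : ∀ᶠ n in atTop, (Rhat a0)^[2 * n] (Rhat a0 ((-a0 : ℂ) : OnePoint ℂ)) ∈ U :=
    (show Tendsto _ _ _ from h) (hUo.mem_nhds hUm)
  obtain ⟨n, hn⟩ := h1.exists
  have hz : ContinuousAt (fun a : ℂ => ((-a : ℂ) : OnePoint ℂ)) a0 :=
    OnePoint.continuous_coe.continuousAt.comp (f := fun a : ℂ => -a) (by fun_prop)
  have hz1 := Rhat_iter_cont ha hz 1
  have hz2 := Rhat_iter_cont ha hz1 (2 * n)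
  have e1 := hz2 (hUo.mem_nhds hn)
  have e2 : ∀ᶠ a in 𝓝 a0, ‖a‖ < 1 + ‖a0‖ :=
    continuous_norm.continuousAt.eventually (gt_mem_nhds (by linarith))
  filter_upwards [e1, e2, isOpen_ne.mem_nhds ha] with a k1 k2 k3 hP
  obtain ⟨u, hu, hu2⟩ := k1
  have hu : ‖u‖ * (8 * (2 + ‖a0‖)) < 1 := hu
  have h3 : sinv u ∈ basI a := small_basI k3 (lt_of_le_of_lt
    (mul_le_mul_of_nonneg_left (by linarith) (norm_nonneg u)) hu)
  rw [hu2] at h3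
  have h4 := (basI_iter n).1 h3
  have h5 : ((-a : ℂ) : OnePoint ℂ) ∈ bas0 a := by
    rw [bas0_eq k3]; exact h4
  exact Set.disjoint_left.1 (bas_disj a) (Ainf_sub k3 hP.2) h5

theorem C5 {a0 : ℂ} (h : a0 ∉ Pinf) {R : ℝ} (hR0 : 0 ≤ R) (hR : R < 1) :
    ∀ᶠ a in 𝓝 a0, a ∈ Pinf → R < ‖Phi a‖ := by
  by_cases hb : a0 ≠ 0 ∧ ((-a0 : ℂ) : OnePoint ℂ) ∈ bas0 a0
  · filter_upwards [bas0_near hb.1 hb.2] with a h1 h2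
    exact absurd h2 h1
  have hN : Never a0 := by
    by_cases ha : a0 = 0
    · rw [ha]; exact never_zero
    intro δ r τ θ F t ht
    exact ⟨fun hx => h (C1 ha F.self ht hx), fun _ hx => hb ⟨ha, C1' ha F.self ht hx⟩⟩
  obtain ⟨ρ, h1, h2⟩ := exists_between (show R ^ 2 < 1 by nlinarith)
  have hρ : 0 < ρ := lt_of_le_of_lt (sq_nonneg R) h1
  obtain ⟨δ, τ, θ, F⟩ := JJ_all hN hρ h2
  have hg : ContinuousOn (fun p : ℂ × ℂ => 1 + p.1 * XX τ p) (ball a0 δ ×ˢ ball 0 (√ρ)) := by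
    have := F.dX.continuousOn
    fun_prop
  obtain ⟨δ', k1, k2, k3⟩ := tube F.δpos (Real.lt_sqrt_of_sq_lt h1) hg (fun t ht => by
    rw [← DD_eq_ball hρ.le] at ht
    exact (hN _ _ _ _ F t ht).1)
  filter_upwards [ball_mem_nhds a0 k1] with a ha hP
  by_contra hcon
  push Not at hcon
  obtain ⟨r, τ', θ', S, m1, m2⟩ := hit_of_mem hP
  refine k3 (a, Phi a) ⟨ha, by simpa using hcon⟩ ?_
  have m3 : Phi a ∈ DD ρ := lt_of_le_of_lt (show ‖Phi a‖ ^ 2 ≤ R ^ 2 by gcongr) h1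
  rw [S.agree_x (F.sol a (ball_subset_ball k2 ha)) m1 m3] at m2
  exact m2

theorem C6 {a : ℂ} (ha : 10000 ≤ ‖a‖) : ∃ t, Hit a t ∧ ‖a * t + 2‖ ≤ 21 / ‖a‖ := by
  have hpos : 0 < ‖a‖ := by linarith
  have ha0 : a ≠ 0 := norm_pos_iff.1 hpos
  have hT3 : ∀ T ∈ closedBall (-2:ℂ) 1, ‖T‖ ≤ 3 := by
    intro T hT
    rw [mem_closedBall, dist_eq_norm] at hT
    have := norm_sub_le (T - -2) 2
    simp at this hT
    linarith
  have hsmall : ∀ T : ℂ, ‖T‖ ≤ 3 → ‖(T / a) ^ 2‖ * (1 + ‖a‖) ≤ 18 / ‖a‖ := by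
    intro T hT
    rw [norm_pow, norm_div, div_pow, div_mul_eq_mul_div, div_le_div_iff₀ (by positivity) hpos]
    have : ‖T‖ ^ 2 ≤ 9 := by nlinarith [norm_nonneg T]
    calc ‖T‖ ^ 2 * (1 + ‖a‖) * ‖a‖ ≤ 9 * (‖a‖ + ‖a‖) * ‖a‖ := by gcongr; linarith
      _ = 18 * ‖a‖ ^ 2 := by ring
  have h18 : 18 / ‖a‖ < 1 / 400 := by
    rw [div_lt_div_iff₀ hpos (by norm_num)]; linarith
  have hOm : ∀ T : ℂ, ‖T‖ ≤ 3 → (a, (T / a) ^ 2) ∈ Omg := fun T hT =>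
    show ‖(T / a) ^ 2‖ * (1 + ‖a‖) < 1 / 100 by linarith [hsmall T hT]
  set h : ℂ → ℂ := fun T => T + tul (a, (T / a) ^ 2) - T / a with hh
  have hbd : ∀ T : ℂ, ‖T‖ ≤ 3 → ‖h T - (T + 2)‖ ≤ 21 / ‖a‖ := by
    intro T hT
    have e : h T - (T + 2) = (tul (a, (T / a) ^ 2) - 2) - T / a := by simp only [hh]; ring
    rw [e]
    have e1 := tul_bd (hOm T hT)
    have e2 : ‖T / a‖ ≤ 3 / ‖a‖ := by rw [norm_div]; gcongr
    have := norm_sub_le (tul (a, (T / a) ^ 2) - 2) (T / a)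
    have e3 := hsmall T hT
    have e4 : 21 / ‖a‖ = 18 / ‖a‖ + 3 / ‖a‖ := by ring
    linarith
  have h21 : 21 / ‖a‖ < 1 / 4 := by
    rw [div_lt_div_iff₀ hpos (by norm_num)]; linarith
  have hdf : ∀ T ∈ closedBall (-2:ℂ) 1, DifferentiableAt ℂ h T := by
    intro T hT
    have h1 : DifferentiableAt ℂ (fun T : ℂ => tul (a, (T / a) ^ 2)) T :=
      DifferentiableAt.comp (f := fun T : ℂ => (a, (T / a) ^ 2)) T
        (tul_diff.differentiableAt (Omg_open.mem_nhds (hOm T (hT3 T hT)))) (by fun_prop)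
    simp only [hh]
    fun_prop
  have hex : ∃ T ∈ closedBall (-2:ℂ) 1, h T = 0 := by
    by_contra hcon
    push Not at hcon
    have hdc : DiffContOnCl ℂ (fun T => (h T)⁻¹) (ball (-2) 1) := by
      refine DifferentiableOn.diffContOnCl ?_
      rw [closure_ball _ one_ne_zero]
      intro T hT
      exact ((hdf T hT).inv (hcon T hT)).differentiableWithinAt
    have := Complex.norm_le_of_forall_mem_frontier_norm_le (C := 2) isBounded_ball hdc (fun T hT => by
      rw [frontier_ball _ one_ne_zero, mem_sphere, dist_eq_norm] at hT
      have h1 := hbd T (hT3 T (by rw [mem_closedBall, dist_eq_norm]; exact hT.le))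
      rw [sub_neg_eq_add] at hT
      have h2 : ‖T + 2‖ ≤ ‖h T‖ + ‖h T - (T + 2)‖ := by
        have := norm_sub_le (h T) (h T - (T + 2))
        simpa using this
      rw [norm_inv]
      refine inv_le_of_inv_le₀ (by norm_num) ?_
      linarith) (subset_closure (mem_ball_self one_pos))
    have h1 := hbd (-2) (by simp; norm_num)
    simp only [neg_add_cancel, sub_zero] at h1
    have h2 : 0 < ‖h (-2)‖ := norm_pos_iff.2 (hcon _ (by simp))
    rw [norm_inv] at this
    have h3 : 4 < ‖h (-2)‖⁻¹ := by
      rw [lt_inv_comm₀ (by norm_num) h2]; linarith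
    linarith
  obtain ⟨T, hT, hT0⟩ := hex
  have hT' := hT3 T hT
  have haT : a * (T / a) = T := by field_simp
  refine ⟨T / a, ⟨1 / (200 * (1 + ‖a‖)), _, _,
    sol_loc (a := a) (by positivity) ?_ ?_, ?_, ?_⟩, ?_⟩
  · rw [div_le_one (by positivity)]; linarith
  · intro t ht
    simp only [mem_ball, dist_zero_right] at ht
    rw [lt_div_iff₀ (by positivity)] at ht
    change ‖t‖ * (1 + ‖a‖) < 1 / 100
    linarith
  · change ‖T / a‖ ^ 2 < _
    rw [lt_div_iff₀ (by positivity)]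
    have := hsmall T hT'
    rw [norm_pow] at this
    linarith
  · have hd : tul (a, (T / a) ^ 2) - T / a ≠ 0 := by
      intro h0
      have h1 : T = 0 := by
        have : h T = T + (tul (a, (T / a) ^ 2) - T / a) := by simp only [hh]; ring
        rw [hT0, h0] at this
        simpa using this.symm
      rw [h1] at hT
      simp [dist_eq_norm] at hT
    unfold xf
    rw [mul_div_assoc', haT, ← div_self hd, ← add_div]
    refine div_eq_zero_iff.2 (Or.inl ?_)
    rw [← hT0]; simp only [hh]; ring
  · rw [haT]
    have := hbd T hT'
    rwa [hT0, zero_sub, norm_neg] at this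

def YY : Set ℂ := {b | b = 0 ∨ b⁻¹ ∈ Pinf}

noncomputable def ff (b : ℂ) : ℂ := if b = 0 then 0 else Phi b⁻¹

theorem ff_ne {b : ℂ} (hb : b ≠ 0) : ff b = Phi b⁻¹ := by simp [ff, hb]
theorem ff_zero : ff 0 = 0 := by simp [ff]

theorem near0 : ∀ᶠ b : ℂ in 𝓝 0, b ∈ YY ∧ (b ≠ 0 → ‖b⁻¹ * ff b + 2‖ ≤ 21 * ‖b‖) := by
  filter_upwards [ball_mem_nhds (0:ℂ) (show (0:ℝ) < 1 / 10000 by norm_num)] with b hb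
  by_cases h : b = 0
  · exact ⟨Or.inl h, fun h' => absurd h h'⟩
  have hb' : ‖b‖ < 1 / 10000 := by simpa using hb
  have hbp : 0 < ‖b‖ := norm_pos_iff.2 h
  obtain ⟨t, h1, h2⟩ := C6 (a := b⁻¹) (by
    rw [norm_inv, le_inv_comm₀ (by norm_num) hbp]; linarith)
  refine ⟨Or.inr h1.mem, fun _ => ?_⟩
  rw [ff_ne h, h1.phi]
  rwa [norm_inv, div_inv_eq_mul] at h2

theorem ff_deriv : HasDerivAt ff (-2) 0 := by
  rw [hasDerivAt_iff_tendsto_slope, tendsto_iff_norm_sub_tendsto_zero]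
  have h1 : Tendsto (fun b : ℂ => 21 * ‖b‖) (𝓝[≠] 0) (𝓝 0) := by
    have : Continuous (fun b : ℂ => 21 * ‖b‖) := by fun_prop
    have := this.tendsto 0
    simp only [norm_zero, mul_zero] at this
    exact this.mono_left nhdsWithin_le_nhds
  refine squeeze_zero' (Eventually.of_forall fun _ => norm_nonneg _) ?_ h1
  filter_upwards [self_mem_nhdsWithin, nhdsWithin_le_nhds near0] with b hb hb2
  have := hb2.2 hb
  simpa [slope, ff_zero, sub_neg_eq_add] using this

theorem zero_not_mem : (0:ℂ) ∉ Pinf := fun h => h.1 rfl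

theorem YY_open : IsOpen YY := by
  rw [isOpen_iff_mem_nhds]
  intro b hb
  by_cases h : b = 0
  · subst h
    filter_upwards [near0] with c hc using hc.1
  · have hb : b⁻¹ ∈ Pinf := hb.resolve_left h
    filter_upwards [(continuousAt_inv₀ h) (C4 hb).1] with c hc using Or.inr hc

theorem ff_diff {b : ℂ} (hb : b ∈ YY) : DifferentiableAt ℂ ff b := by
  by_cases h : b = 0
  · subst h; exact ff_deriv.differentiableAt
  · have hb : b⁻¹ ∈ Pinf := hb.resolve_left h
    have : DifferentiableAt ℂ (fun b => Phi b⁻¹) b :=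
      DifferentiableAt.comp (f := fun b : ℂ => b⁻¹) b (C4 hb).2 (differentiableAt_inv h)
    refine this.congr_of_eventuallyEq ?_
    filter_upwards [isOpen_ne.mem_nhds h] with c hc using ff_ne hc

theorem ff_cpt {r : ℝ} (hr : r < 1) : IsCompact {y | y ∈ YY ∧ ‖ff y‖ ≤ r} := by
  have hR0 : (0:ℝ) ≤ max r 0 := le_max_right _ _
  have hR1 : max r 0 < 1 := max_lt hr one_pos
  refine Metric.isCompact_of_isClosed_isBounded ?_ ?_
  · rw [← isOpen_compl_iff, isOpen_iff_mem_nhds]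
    intro b hb
    by_cases hY : b ∈ YY
    · have hlt : r < ‖ff b‖ := by
        by_contra hc
        exact hb ⟨hY, not_lt.1 hc⟩
      filter_upwards [(ff_diff hY).continuousAt.norm.eventually (lt_mem_nhds hlt)] with c hc h2
      exact absurd h2.2 (not_le.2 hc)
    · have h0 : b ≠ 0 := fun h => hY (Or.inl h)
      have h1 : b⁻¹ ∉ Pinf := fun h => hY (Or.inr h)
      filter_upwards [(continuousAt_inv₀ h0).eventually (C5 h1 hR0 hR1), isOpen_ne.mem_nhds h0] with c hc hc0 h2
      have := hc (h2.1.resolve_left hc0)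
      have h3 := h2.2
      rw [ff_ne hc0] at h3
      exact absurd ((le_max_left r 0).trans_lt this) (not_lt.2 h3)
  · obtain ⟨ε, hε, h⟩ := Metric.eventually_nhds_iff_ball.1 (C5 zero_not_mem hR0 hR1)
    refine (isBounded_closedBall (x := (0:ℂ)) (r := ε⁻¹)).subset ?_
    rintro b ⟨h1, h2⟩
    rw [mem_closedBall, dist_zero_right]
    by_cases h0 : b = 0
    · rw [h0, norm_zero]; positivity
    by_contra hc
    push Not at hc
    have hbp : 0 < ‖b‖ := norm_pos_iff.2 h0
    have := h b⁻¹ (by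
      rw [mem_ball, dist_zero_right, norm_inv]
      exact inv_lt_of_inv_lt₀ hε hc) (h1.resolve_left h0)
    rw [ff_ne h0] at h2
    exact absurd ((le_max_left r 0).trans_lt this) (not_lt.2 h2)

theorem YY_sc : SimplyConnectedSpace YY := by
  refine simplyConnected_of_proper YY_open (fun b hb => (ff_diff hb).differentiableWithinAt)
    ?_ (fun r hr => ff_cpt hr) (Or.inl rfl) ff_zero ?_ (by rw [ff_deriv.deriv]; norm_num)
  · intro b hb
    by_cases h : b = 0
    · rw [h, ff_zero]; simp
    · rw [ff_ne h]; exact (hit_of_mem (hb.resolve_left h)).norm_lt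
  · intro b hb h0
    by_contra h
    rw [ff_ne h] at h0
    exact (hit_of_mem (hb.resolve_left h)).ne h0

theorem sinv_YY : sinv '' YY = (((↑) : ℂ → OnePoint ℂ) '' Pinf) ∪ {∞} := by
  ext z
  constructor
  · rintro ⟨b, hb, rfl⟩
    by_cases h : b = 0
    · right; rw [h, sinv_zero]; rfl
    · left
      exact ⟨b⁻¹, hb.resolve_left h, (sinv_ne h).symm⟩
  · rintro (⟨a, ha, rfl⟩ | h)
    · refine ⟨a⁻¹, Or.inr (by rwa [inv_inv]), ?_⟩
      rw [sinv_ne (inv_ne_zero ha.1), inv_inv]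
    · rw [mem_singleton_iff] at h
      exact ⟨0, Or.inl rfl, by rw [h, sinv_zero]⟩

theorem final_sc : SimplyConnectedSpace ↥((((↑) : ℂ → OnePoint ℂ) '' Pinf) ∪ {∞}) := by
  rw [← sinv_YY]
  have := YY_sc
  exact (sinv_emb.isEmbedding.homeomorphImage YY).symm.toHomotopyEquiv.simplyConnectedSpace
end

/-- `P_∞ ∪ {∞}` is a simply connected subset of the Riemann sphere. -/
theorem Pinf_union_infty_simplyConnected :
    SimplyConnectedSpace ↥((((↑) : ℂ → RSphere) '' Pinf) ∪ {∞}) := by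
  exact final_sc
end

section
/- For every n ≥ 1, the degree of the rational function ξ_n equals (2^n − (−1)^n)/3, i.e. the integer nearest to 2^n/3. (Here ξ_n(a) = R_a^n(−1) is the n-th iterate of the critical point −1 under R_a(z) = a/(z² + 2z), regarded as a rational function of the parameter a.) -/
/-- `ξ_n(a) = R_a^n(−1)` as a rational function of the parameter `a`:
`ξ_0 = −1` and `ξ_{n+1} = a / (ξ_n² + 2·ξ_n)`, so that `ξ_1 = −a`. -/
noncomputable def xiFun : ℕ → RatFunc ℂ
  | 0 => -1
  | n + 1 => RatFunc.X / (xiFun n ^ 2 + 2 * xiFun n)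

/-- The degree of a rational function: the maximum of the degrees of its numerator and
denominator (in lowest terms). -/
noncomputable def ratDegree (r : RatFunc ℂ) : ℕ := max r.num.natDegree r.denom.natDegree

open Polynomial in
theorem ratDegree_div_coprime (p q : ℂ[X]) (hq : q ≠ 0) (h : IsCoprime p q) :
    ratDegree (algebraMap ℂ[X] (RatFunc ℂ) p / algebraMap ℂ[X] (RatFunc ℂ) q)
      = max p.natDegree q.natDegree := by
  have hg : gcd p q = 1 := by
    rw [← normalize_gcd, normalize_eq_one]
    exact h.isUnit_of_dvd' (gcd_dvd_left p q) (gcd_dvd_right p q)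
  have hl : q.leadingCoeff⁻¹ ≠ 0 := inv_ne_zero (leadingCoeff_ne_zero.mpr hq)
  unfold ratDegree
  rw [RatFunc.num_div, RatFunc.denom_div p hq, hg]
  simp only [EuclideanDomain.div_one]
  rw [natDegree_C_mul hl, natDegree_C_mul hl]

open Polynomial in
/-- The odd-index invariant: `r = X p / q` in lowest terms, with `deg p = D ≥ deg q` and
with derivative `s ≤ -1` at the origin. -/
def OddInv (r : RatFunc ℂ) (D : ℕ) : Prop :=
  ∃ (p q : ℂ[X]) (s : ℝ), r = algebraMap ℂ[X] (RatFunc ℂ) (X * p) / algebraMap ℂ[X] (RatFunc ℂ) q ∧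
    IsCoprime (X * p) q ∧ p ≠ 0 ∧ p.natDegree = D ∧ q.natDegree ≤ D ∧
    q.eval 0 ≠ 0 ∧ p.eval 0 = (s : ℂ) * q.eval 0 ∧ s ≤ -1

open Polynomial in
theorem isCoprime_step (u v : ℂ[X]) (h : IsCoprime u v) : IsCoprime (v ^ 2) (u * (u + 2 * v)) := by
  apply IsCoprime.pow_left
  apply IsCoprime.mul_right h.symm
  have := h.symm.add_mul_left_right 2
  rwa [mul_comm v 2] at this

open Polynomial in
theorem isCoprime_X_of_eval (q : ℂ[X]) (h : q.eval 0 ≠ 0) : IsCoprime X q := by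
  rw [irreducible_X.coprime_iff_not_dvd, X_dvd_iff, coeff_zero_eq_eval_zero]
  exact h

open Polynomial in
theorem xi_step (r : RatFunc ℂ) (u v : ℂ[X]) (hv : v ≠ 0)
    (hr : r = algebraMap ℂ[X] (RatFunc ℂ) u / algebraMap ℂ[X] (RatFunc ℂ) v) :
    RatFunc.X / (r ^ 2 + 2 * r) =
      algebraMap ℂ[X] (RatFunc ℂ) (X * v ^ 2) / algebraMap ℂ[X] (RatFunc ℂ) (u * (u + 2 * v)) := by
  have hv' : algebraMap ℂ[X] (RatFunc ℂ) v ≠ 0 := RatFunc.algebraMap_ne_zero hv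
  have h : r ^ 2 + 2 * r = algebraMap ℂ[X] (RatFunc ℂ) (u * (u + 2 * v)) /
      algebraMap ℂ[X] (RatFunc ℂ) (v ^ 2) := by
    subst hr
    simp only [map_mul, map_add, map_pow, map_ofNat]
    field_simp
  rw [h, div_div_eq_mul_div, ← RatFunc.algebraMap_X, ← map_mul]

open Polynomial in
theorem oddInv_step (r : RatFunc ℂ) (D : ℕ) (h : OddInv r D) :
    ratDegree r = D + 1 ∧ ratDegree (RatFunc.X / (r ^ 2 + 2 * r)) = 2 * D + 1 ∧
    ∀ t, t = RatFunc.X / (r ^ 2 + 2 * r) → OddInv (RatFunc.X / (t ^ 2 + 2 * t)) (4 * D + 2) := by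
  obtain ⟨p, q, s, hr, hc, hp, hpD, hqD, hq0, hs, hs1⟩ := h
  have hq : q ≠ 0 := by rintro rfl; simp at hq0
  have hXp : (X * p).natDegree = D + 1 := by rw [natDegree_X_mul hp, hpD]
  have h2q : (2 * q).natDegree = q.natDegree := by
    have : (2 : ℂ[X]) * q = C 2 * q := by rw [map_ofNat]
    rw [this, natDegree_C_mul (by norm_num)]
  have hw : (X * p + 2 * q).natDegree = D + 1 := by
    rw [natDegree_add_eq_left_of_natDegree_lt, hXp]
    omega
  have hw0 : X * p + 2 * q ≠ 0 := by rintro h; rw [h] at hw; simp at hw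
  set v := p * (X * p + 2 * q) with hv
  have hv0 : v ≠ 0 := mul_ne_zero hp hw0
  have hvD : v.natDegree = 2 * D + 1 := by rw [hv, natDegree_mul hp hw0, hpD, hw]; ring
  have huD : (q ^ 2).natDegree ≤ 2 * D := by rw [natDegree_pow]; omega
  have hcop : IsCoprime (q ^ 2) v := by
    have h1 := isCoprime_step _ _ hc
    have : X * p * (X * p + 2 * q) = X * v := by rw [hv]; ring
    rw [this] at h1
    exact h1.of_mul_right_right
  have ht : RatFunc.X / (r ^ 2 + 2 * r) =
      algebraMap ℂ[X] (RatFunc ℂ) (q ^ 2) / algebraMap ℂ[X] (RatFunc ℂ) v := by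
    rw [xi_step r _ q hq hr]
    have : X * p * (X * p + 2 * q) = X * v := by rw [hv]; ring
    rw [this, map_mul, map_mul, mul_div_mul_left]
    exact RatFunc.algebraMap_ne_zero X_ne_zero
  refine ⟨?_, ?_, ?_⟩
  · rw [hr, ratDegree_div_coprime _ _ hq hc, hXp]; omega
  · rw [ht, ratDegree_div_coprime _ _ hv0 hcop, hvD]; omega
  · intro t htt
    rw [ht] at htt
    have hs4 : (1 + 4 * (s : ℂ)) ≠ 0 := by
      have : (1 + 4 * s) ≠ 0 := by linarith
      exact_mod_cast this
    have h2v : (2 * v).natDegree = v.natDegree := by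
      have : (2 : ℂ[X]) * v = C 2 * v := by rw [map_ofNat]
      rw [this, natDegree_C_mul (by norm_num)]
    have hve : v.eval 0 = 2 * s * (q.eval 0) ^ 2 := by
      rw [hv]; simp [hs]; ring
    have hev : (q ^ 2 * (q ^ 2 + 2 * v)).eval 0 = (q.eval 0) ^ 4 * (1 + 4 * s) := by
      simp [hve]; ring
    have hev0 : (q ^ 2 * (q ^ 2 + 2 * v)).eval 0 ≠ 0 := by
      rw [hev]; exact mul_ne_zero (pow_ne_zero _ hq0) hs4
    refine ⟨v ^ 2, q ^ 2 * (q ^ 2 + 2 * v), 4 * s ^ 2 / (1 + 4 * s), xi_step t _ v hv0 htt,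
      (isCoprime_X_of_eval _ hev0).mul_left (isCoprime_step _ _ hcop), pow_ne_zero _ hv0, ?_, ?_,
      hev0, ?_, ?_⟩
    · rw [natDegree_pow, hvD]; ring
    · refine natDegree_mul_le.trans ?_
      have := natDegree_add_le (q ^ 2) (2 * v)
      rw [h2v, hvD] at this
      omega
    · rw [hev, eval_pow, hve]; push_cast
      rw [div_mul_eq_mul_div, eq_div_iff hs4]; ring
    · rw [div_le_iff_of_neg (by linarith)]; nlinarith [sq_nonneg (2 * s + 1)]

open Polynomial in
theorem oddInv_xi (k : ℕ) : ∃ D : ℕ, 3 * D + 2 = 2 ^ (2 * k + 1) ∧ OddInv (xiFun (2 * k + 1)) D := by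
  induction k with
  | zero =>
    refine ⟨0, by norm_num, -1, 1, -1, ?_, isCoprime_one_right, by simp, by simp, by simp, by simp,
      by simp, le_refl _⟩
    simp [xiFun]
    norm_num
    rw [div_eq_iff (neg_ne_zero.mpr one_ne_zero)]; ring
  | succ k ih =>
    obtain ⟨D, hD, h⟩ := ih
    refine ⟨4 * D + 2, ?_, (oddInv_step _ _ h).2.2 (xiFun (2 * k + 2)) rfl⟩
    have : 2 ^ (2 * (k + 1) + 1) = 4 * 2 ^ (2 * k + 1) := by ring
    omega

/-- For every `n ≥ 1`, the degree of `ξ_n` equals `(2^n − (−1)^n)/3`, the integer nearest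
to `2^n/3`. -/
theorem xiFun_degree (n : ℕ) (hn : 1 ≤ n) :
    (ratDegree (xiFun n) : ℤ) = (2 ^ n - (-1) ^ n) / 3 := by
  rcases Nat.even_or_odd' n with ⟨k, rfl | rfl⟩
  · obtain ⟨j, rfl⟩ : ∃ j, k = j + 1 := ⟨k - 1, by omega⟩
    obtain ⟨D, hD, h⟩ := oddInv_xi j
    have h2 : ratDegree (xiFun (2 * (j + 1))) = 2 * D + 1 := (oddInv_step _ _ h).2.1
    have h3 : (2 : ℤ) ^ (2 * (j + 1)) = 2 * (3 * D + 2) := by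
      have : (3 * D + 2 : ℤ) = 2 ^ (2 * j + 1) := by exact_mod_cast hD
      rw [this]; ring
    rw [h2, h3, pow_mul]
    simp
    omega
  · obtain ⟨D, hD, h⟩ := oddInv_xi k
    have h3 : (2 : ℤ) ^ (2 * k + 1) = 3 * D + 2 := by exact_mod_cast hD.symm
    rw [(oddInv_step _ _ h).1, h3, pow_succ, pow_mul]
    simp
    omega
end
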